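/- arXiv:1112.2455 — 15 statements merged into one kernel-verified Lean document; each statement's English description precedes it below -/
import Mathlib

section
/- Let D be a linear endomorphism of 𝔤₁. (i) If β ≠ 0, then D is a derivation of 𝔤₁ if and only if there exist real numbers p, q, r such that D e₁ = p e₁ − (β/α) r e₂ − (β/α)(p + r) e₃, D e₂ = q e₁ + r e₂ + ((β²/α² + 1) r − (β/α) q) e₃, and D e₃ = (−(β/α) p − q) e₁ + (−p + (β²/α² − 1) r − (β/α) q) e₂ − (p + r) e₃. (ii) If β = 0, then D is a derivation of 𝔤₁ if and only if there exist real numbers p, q, r, s such that D e₁ = p e₁, D e₂ = q e₁ + r e₂ + r e₃, and D e₃ = −q e₁ + s e₂ + s e₃. -/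
/-- Bracket of the Lie algebra 𝔤₁ in coordinates w.r.t. the basis {e₁,e₂,e₃}:
[e₁,e₂] = α e₁ − β e₃, [e₁,e₃] = −α e₁ − β e₂, [e₂,e₃] = β e₁ + α e₂ + α e₃. -/
noncomputable def g1bra (α β : ℝ) (X Y : Fin 3 → ℝ) : Fin 3 → ℝ :=
  ![(X 0 * Y 1 - X 1 * Y 0) * α - (X 0 * Y 2 - X 2 * Y 0) * α + (X 1 * Y 2 - X 2 * Y 1) * β,
    -(X 0 * Y 2 - X 2 * Y 0) * β + (X 1 * Y 2 - X 2 * Y 1) * α,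
    -(X 0 * Y 1 - X 1 * Y 0) * β + (X 1 * Y 2 - X 2 * Y 1) * α]

/-- `D` is a derivation of 𝔤₁. -/
def g1IsDeriv (α β : ℝ) (D : (Fin 3 → ℝ) →ₗ[ℝ] (Fin 3 → ℝ)) : Prop :=
  ∀ X Y, D (g1bra α β X Y) = g1bra α β (D X) Y + g1bra α β X (D Y)

theorem apply_eq_smul_basis (D : (Fin 3 → ℝ) →ₗ[ℝ] (Fin 3 → ℝ)) (X : Fin 3 → ℝ) :
    D X = X 0 • D ![1, 0, 0] + X 1 • D ![0, 1, 0] + X 2 • D ![0, 0, 1] := by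
  rw [← map_smul, ← map_smul, ← map_smul, ← map_add, ← map_add]
  congr 1
  ext i
  fin_cases i <;> simp

/-- The derivation property amounts to the linear equations obtained from the brackets of basis
vectors; here `β = t * α`. -/
theorem g1IsDeriv_iff_entries {α : ℝ} (hα : α ≠ 0) (t : ℝ)
    (D : (Fin 3 → ℝ) →ₗ[ℝ] (Fin 3 → ℝ)) (x y z : Fin 3 → ℝ)
    (hx : D ![1, 0, 0] = x) (hy : D ![0, 1, 0] = y) (hz : D ![0, 0, 1] = z) :
    g1IsDeriv α (t * α) D ↔
      (-t * z 0 = -t * x 2 + y 1 - y 2 ∧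
       x 1 - t * z 1 = -x 2 - t * y 2 ∧
       x 2 - t * z 2 = -t * x 0 - x 2 - t * y 1) ∧
      (-x 0 - t * y 0 = -x 0 + t * x 1 + z 1 - z 2 ∧
       -x 1 - t * y 1 = -t * x 0 + x 1 - t * z 2 ∧
       -x 2 - t * y 2 = x 1 - t * z 1) ∧
      (t * x 0 + y 0 + z 0 = -y 0 + t * y 1 - z 0 + t * z 2 ∧
       t * x 1 + y 1 + z 1 = -t * y 0 + y 1 + z 2 ∧
       t * x 2 + y 2 + z 2 = t * z 0 + y 1 + z 2) := by
  have hD := apply_eq_smul_basis D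
  rw [hx, hy, hz] at hD
  constructor
  · intro h
    have h01 := h ![1, 0, 0] ![0, 1, 0]
    have h02 := h ![1, 0, 0] ![0, 0, 1]
    have h12 := h ![0, 1, 0] ![0, 0, 1]
    rw [hD (g1bra _ _ _ _), hx, hy] at h01
    rw [hD (g1bra _ _ _ _), hx, hz] at h02
    rw [hD (g1bra _ _ _ _), hy, hz] at h12
    simp only [funext_iff, Fin.forall_fin_succ, g1bra] at h01 h02 h12
    simp at h01 h02 h12
    obtain ⟨a0, a1, a2⟩ := h01
    obtain ⟨b0, b1, b2⟩ := h02
    obtain ⟨c0, c1, c2⟩ := h12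
    refine ⟨⟨?_, ?_, ?_⟩, ⟨?_, ?_, ?_⟩, ⟨?_, ?_, ?_⟩⟩ <;> apply mul_left_cancel₀ hα
    · linear_combination a0
    · linear_combination a1
    · linear_combination a2
    · linear_combination b0
    · linear_combination b1
    · linear_combination b2
    · linear_combination c0
    · linear_combination c1
    · linear_combination c2
  · rintro ⟨⟨a0, a1, a2⟩, ⟨b0, b1, b2⟩, ⟨c0, c1, c2⟩⟩ X Y
    rw [hD (g1bra _ _ _ _), hD X, hD Y]
    simp only [funext_iff, Fin.forall_fin_succ, g1bra]
    simp
    refine ⟨?_, ?_, ?_⟩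
    · linear_combination (X 0 * Y 1 - X 1 * Y 0) * α * a0 + (X 0 * Y 2 - X 2 * Y 0) * α * b0 +
        (X 1 * Y 2 - X 2 * Y 1) * α * c0
    · linear_combination (X 0 * Y 1 - X 1 * Y 0) * α * a1 + (X 0 * Y 2 - X 2 * Y 0) * α * b1 +
        (X 1 * Y 2 - X 2 * Y 1) * α * c1
    · linear_combination (X 0 * Y 1 - X 1 * Y 0) * α * a2 + (X 0 * Y 2 - X 2 * Y 0) * α * b2 +
        (X 1 * Y 2 - X 2 * Y 1) * α * c2

theorem stmt0 (α β : ℝ) (hα : α ≠ 0) (D : (Fin 3 → ℝ) →ₗ[ℝ] (Fin 3 → ℝ)) :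
    (β ≠ 0 → (g1IsDeriv α β D ↔ ∃ p q r : ℝ,
        D ![1, 0, 0] = ![p, -(β / α) * r, -(β / α) * (p + r)] ∧
        D ![0, 1, 0] = ![q, r, (β ^ 2 / α ^ 2 + 1) * r - (β / α) * q] ∧
        D ![0, 0, 1] = ![-(β / α) * p - q, -p + (β ^ 2 / α ^ 2 - 1) * r - (β / α) * q,
          -(p + r)])) ∧
    (β = 0 → (g1IsDeriv α β D ↔ ∃ p q r s : ℝ,
        D ![1, 0, 0] = ![p, 0, 0] ∧
        D ![0, 1, 0] = ![q, r, r] ∧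
        D ![0, 0, 1] = ![-q, s, s])) := by
  obtain ⟨t, rfl⟩ : ∃ t, β = t * α := ⟨β / α, by field_simp⟩
  have ht : t * α / α = t := by field_simp
  rw [← div_pow, ht]
  constructor
  · intro hβ
    have ht0 : t ≠ 0 := left_ne_zero_of_mul hβ
    constructor
    · intro h
      generalize hx : D ![1, 0, 0] = x
      generalize hy : D ![0, 1, 0] = y
      generalize hz : D ![0, 0, 1] = z
      obtain ⟨⟨a0, a1, a2⟩, ⟨b0, b1, b2⟩, ⟨c0, c1, c2⟩⟩ :=
        (g1IsDeriv_iff_entries hα t D x y z hx hy hz).1 h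
      have trace_zero : x 0 + y 1 + z 2 = 0 := by
        have key : t ^ 3 * (x 0 + y 1 + z 2) = 0 := by
          linear_combination 2 * a1 - 2 * t * b0 - 2 * t * a0 - t ^ 2 * c0 + (1 + t ^ 2) * b1 -
            (1 - t ^ 2) * a2
        exact (mul_eq_zero.1 key).resolve_left (pow_ne_zero 3 ht0)
      have hz2 : z 2 = -(x 0 + y 1) := by linear_combination trace_zero
      have hx1 : x 1 = -t * y 1 := by rw [hz2] at b1; linear_combination -b1 / 2
      have hx2 : x 2 = -t * (x 0 + y 1) := by rw [hz2] at a2; linear_combination a2 / 2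
      have hz0 : z 0 = -t * x 0 - y 0 := by rw [hz2] at c0; linear_combination c0 / 2
      have hy2 : y 2 = (t ^ 2 + 1) * y 1 - t * y 0 := by
        rw [hx2, hz0] at a0; linear_combination a0
      have hz1 : z 1 = -x 0 + (t ^ 2 - 1) * y 1 - t * y 0 := by
        rw [hx1, hz2] at b0; linear_combination -b0
      refine ⟨x 0, y 0, y 1, ?_, ?_, ?_⟩ <;> ext i <;> fin_cases i <;> simp <;> linarith
    · rintro ⟨p, q, r, hx, hy, hz⟩
      rw [g1IsDeriv_iff_entries hα t D _ _ _ hx hy hz]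
      simp
      refine ⟨⟨?_, ?_, ?_⟩, ⟨?_, ?_, ?_⟩, ⟨?_, ?_, ?_⟩⟩ <;> ring
  · intro hβ
    obtain rfl : t = 0 := (mul_eq_zero.1 hβ).resolve_right hα
    constructor
    · intro h
      generalize hx : D ![1, 0, 0] = x
      generalize hy : D ![0, 1, 0] = y
      generalize hz : D ![0, 0, 1] = z
      obtain ⟨⟨a0, a1, a2⟩, ⟨b0, b1, b2⟩, ⟨c0, c1, c2⟩⟩ :=
        (g1IsDeriv_iff_entries hα 0 D x y z hx hy hz).1 h
      refine ⟨x 0, y 0, y 1, z 1, ?_, ?_, ?_⟩ <;> ext i <;> fin_cases i <;> simp <;> linarith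
    · rintro ⟨p, q, r, s, hx, hy, hz⟩
      rw [g1IsDeriv_iff_entries hα 0 D _ _ _ hx hy hz]
      simp
end

section
/- There exist a real number c and a derivation D of 𝔤₁ such that Ric = c·Id + D if and only if β = 0. Moreover, when β = 0 the only such pair is c = 0 and D = Ric, i.e. D e₁ = 0, D e₂ = −2α² e₂ − 2α² e₃, D e₃ = 2α² e₂ + 2α² e₃. -/
/-- The Ricci operator of (G₁, g). -/
noncomputable def g1Ric (α β : ℝ) : (Fin 3 → ℝ) →ₗ[ℝ] (Fin 3 → ℝ) :=
  Matrix.toLin' !![-β ^ 2 / 2, -α * β, α * β;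
                   -α * β, -2 * α ^ 2 - β ^ 2 / 2, 2 * α ^ 2;
                   -α * β, -2 * α ^ 2, 2 * α ^ 2 - β ^ 2 / 2]

theorem g1Ric_apply (α β : ℝ) (X : Fin 3 → ℝ) :
    g1Ric α β X =
      ![-β ^ 2 / 2 * X 0 - α * β * X 1 + α * β * X 2,
        -α * β * X 0 + (-2 * α ^ 2 - β ^ 2 / 2) * X 1 + 2 * α ^ 2 * X 2,
        -α * β * X 0 - 2 * α ^ 2 * X 1 + (2 * α ^ 2 - β ^ 2 / 2) * X 2] := by
  ext i
  fin_cases i <;>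
    simp [g1Ric, Matrix.toLin'_apply, Matrix.mulVec, dotProduct, Fin.sum_univ_three] <;> ring

theorem g1IsDeriv_g1Ric_zero (α : ℝ) : g1IsDeriv α 0 (g1Ric α 0) := by
  intro X Y
  ext i
  fin_cases i <;> simp [g1Ric_apply, g1bra] <;> ring

theorem eq_zero_of_g1IsDeriv_g1Ric_sub {α β c : ℝ} (hα : α ≠ 0)
    (h : g1IsDeriv α β (g1Ric α β - c • LinearMap.id)) : β = 0 ∧ c = 0 := by
  have h_beta := congrFun (h ![1, 0, 0] ![0, 1, 0]) 1
  have h_c := congrFun (h ![1, 0, 0] ![0, 0, 1]) 0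
  simp [g1Ric_apply, g1bra] at h_beta h_c
  have hβ : β = 0 := by
    have : α ^ 2 * β = 0 := by linarith
    simpa [hα] using this
  subst hβ
  have : α * c = 0 := by linarith
  exact ⟨rfl, by simpa [hα] using this⟩

theorem stmt1 (α β : ℝ) (hα : α ≠ 0) :
    ((∃ (c : ℝ) (D : (Fin 3 → ℝ) →ₗ[ℝ] (Fin 3 → ℝ)), g1IsDeriv α β D ∧
        g1Ric α β = c • (LinearMap.id : (Fin 3 → ℝ) →ₗ[ℝ] (Fin 3 → ℝ)) + D) ↔ β = 0) ∧
    (β = 0 → ∀ (c : ℝ) (D : (Fin 3 → ℝ) →ₗ[ℝ] (Fin 3 → ℝ)),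
      (g1IsDeriv α β D ∧
        g1Ric α β = c • (LinearMap.id : (Fin 3 → ℝ) →ₗ[ℝ] (Fin 3 → ℝ)) + D) ↔
      (c = 0 ∧ D = g1Ric α β ∧ D ![1, 0, 0] = 0 ∧
        D ![0, 1, 0] = ![0, -2 * α ^ 2, -2 * α ^ 2] ∧
        D ![0, 0, 1] = ![0, 2 * α ^ 2, 2 * α ^ 2])) := by
  have key : ∀ (c : ℝ) (D : (Fin 3 → ℝ) →ₗ[ℝ] (Fin 3 → ℝ)), g1IsDeriv α β D →
      g1Ric α β = c • (LinearMap.id : (Fin 3 → ℝ) →ₗ[ℝ] (Fin 3 → ℝ)) + D → β = 0 ∧ c = 0 := by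
    intro c D hD h
    obtain rfl : D = g1Ric α β - c • LinearMap.id := eq_sub_of_add_eq' h.symm
    exact eq_zero_of_g1IsDeriv_g1Ric_sub hα hD
  refine ⟨⟨fun ⟨c, D, hD, h⟩ => (key c D hD h).1, ?_⟩, ?_⟩
  · rintro rfl
    exact ⟨0, g1Ric α 0, g1IsDeriv_g1Ric_zero α, by simp⟩
  · rintro rfl c D
    constructor
    · rintro ⟨hD, h⟩
      obtain rfl := (key c D hD h).2
      obtain rfl : g1Ric α 0 = D := by simpa using h
      refine ⟨rfl, rfl, ?_, ?_, ?_⟩ <;> simp [g1Ric_apply]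
    · rintro ⟨rfl, rfl, -⟩
      exact ⟨g1IsDeriv_g1Ric_zero α, by simp⟩
end

section
/- Suppose β ≠ 0. Then a pair (Y, c) with Y ∈ 𝔤₁ and c ∈ ℝ satisfies ρ = c·g + L_Y g if and only if Y = β e₁ − α e₂ − α e₃ and c = −β²/2. -/
/-- The Lorentzian inner product: {e₁,e₂,e₃} pseudo-orthonormal with e₃ timelike. -/
noncomputable def lmet (X Y : Fin 3 → ℝ) : ℝ :=
  X 0 * Y 0 + X 1 * Y 1 - X 2 * Y 2

/-- The Lie derivative of g along the left-invariant vector field determined by Y. -/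
noncomputable def g1lie (α β : ℝ) (Y X Z : Fin 3 → ℝ) : ℝ :=
  -lmet (g1bra α β Y X) Z - lmet X (g1bra α β Y Z)

theorem stmt3 (α β : ℝ) (hα : α ≠ 0) (hβ : β ≠ 0) (Y : Fin 3 → ℝ) (c : ℝ) :
    (∀ X Z : Fin 3 → ℝ, lmet (g1Ric α β X) Z = c * lmet X Z + g1lie α β Y X Z) ↔
      (Y = ![β, -α, -α] ∧ c = -β ^ 2 / 2) := by
  constructor
  · intro h
    have h11 := h ![1, 0, 0] ![1, 0, 0]
    have h12 := h ![1, 0, 0] ![0, 1, 0]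
    have h22 := h ![0, 1, 0] ![0, 1, 0]
    have h23 := h ![0, 1, 0] ![0, 0, 1]
    simp [lmet, g1Ric, g1lie, g1bra, Matrix.mulVec, dotProduct, Fin.sum_univ_three]
      at h11 h12 h22 h23
    have hY0 : Y 0 = β := mul_left_cancel₀ hα (by linarith)
    have hY2 : Y 2 = -α := mul_left_cancel₀ hα (by linarith)
    have hY1 : Y 1 = -α := mul_left_cancel₀ hα (by linarith)
    refine ⟨?_, ?_⟩
    · ext i
      fin_cases i <;> simp [hY0, hY1, hY2]
    · rw [hY1, hY2] at h11
      linarith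
  · rintro ⟨rfl, rfl⟩ X Z
    simp [lmet, g1Ric, g1lie, g1bra, Matrix.mulVec, dotProduct, Fin.sum_univ_three]
    ring
end

section
/- Suppose β ≠ 0. Then: (a) there exist Y ∈ 𝔤₁ and c ∈ ℝ such that ρ = c·g + L_Y g (namely Y = β e₁ − α e₂ − α e₃ and c = −β²/2); but (b) there exist no real number c and derivation D of 𝔤₁ with Ric = c·Id + D. In other words, the left-invariant Lorentzian metric on the Lie group with Lie algebra 𝔤₁ (which is SL(2,ℝ) when β ≠ 0) is a left-invariant Ricci soliton that is not an algebraic Ricci soliton. -/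
/-- For β ≠ 0, (G₁,g) is a left-invariant Ricci soliton (with Y = β e₁ − α e₂ − α e₃ and
c = −β²/2) which is not an algebraic Ricci soliton. -/
theorem stmt4 (α β : ℝ) (hα : α ≠ 0) (hβ : β ≠ 0) :
    (∀ X Z : Fin 3 → ℝ, lmet (g1Ric α β X) Z =
        (-β ^ 2 / 2) * lmet X Z + g1lie α β ![β, -α, -α] X Z) ∧
    ¬ ∃ (c : ℝ) (D : (Fin 3 → ℝ) →ₗ[ℝ] (Fin 3 → ℝ)), g1IsDeriv α β D ∧
        g1Ric α β = c • (LinearMap.id : (Fin 3 → ℝ) →ₗ[ℝ] (Fin 3 → ℝ)) + D := by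
  refine ⟨fun X Z => ?_, ?_⟩
  · simp [lmet, g1Ric_apply, g1lie, g1bra]
    ring
  · rintro ⟨c, D, hD, h⟩
    obtain rfl : D = g1Ric α β - c • LinearMap.id := by rw [h]; abel
    have h12 := congrFun (hD ![1, 0, 0] ![0, 1, 0]) 1
    simp [g1Ric_apply, g1bra] at h12
    exact mul_ne_zero (pow_ne_zero 2 hα) hβ (by linarith)
end

section
/- Let D be a linear endomorphism of 𝔤₂. (i) If α ≠ 0, then D is a derivation of 𝔤₂ if and only if there exist real numbers q, u, r such that D e₁ = −(1/α)(γ u + β q) e₂ + (1/α)(β u − γ q) e₃, D e₂ = q e₁ + r e₂ − (β/γ) r e₃, and D e₃ = u e₁ − (β/γ) r e₂ − r e₃. (ii) If α = 0, then D is a derivation of 𝔤₂ if and only if there exist real numbers p, q, r, s such that D e₁ = p e₂ + q e₃, D e₂ = r e₂ + (β/(2γ))(s − r) e₃, and D e₃ = (β/(2γ))(s − r) e₂ + s e₃. -/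
/-- Bracket of the Lie algebra 𝔤₂ in coordinates w.r.t. the basis {e₁,e₂,e₃}:
[e₁,e₂] = γ e₂ − β e₃, [e₁,e₃] = −β e₂ − γ e₃, [e₂,e₃] = α e₁. -/
noncomputable def g2bra (α β γ : ℝ) (X Y : Fin 3 → ℝ) : Fin 3 → ℝ :=
  ![(X 1 * Y 2 - X 2 * Y 1) * α,
    (X 0 * Y 1 - X 1 * Y 0) * γ - (X 0 * Y 2 - X 2 * Y 0) * β,
    -(X 0 * Y 1 - X 1 * Y 0) * β - (X 0 * Y 2 - X 2 * Y 0) * γ]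

/-- `D` is a derivation of 𝔤₂. -/
def g2IsDeriv (α β γ : ℝ) (D : (Fin 3 → ℝ) →ₗ[ℝ] (Fin 3 → ℝ)) : Prop :=
  ∀ X Y, D (g2bra α β γ X Y) = g2bra α β γ (D X) Y + g2bra α β γ X (D Y)

theorem linearMap_apply_fin_three (D : (Fin 3 → ℝ) →ₗ[ℝ] (Fin 3 → ℝ)) (v : Fin 3 → ℝ) :
    D v = v 0 • D ![1, 0, 0] + v 1 • D ![0, 1, 0] + v 2 • D ![0, 0, 1] := by
  simp only [← map_smul, ← map_add]
  congr 1
  ext i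
  fin_cases i <;> simp

theorem eq_vec_fin_three_iff (v : Fin 3 → ℝ) (x y z : ℝ) :
    v = ![x, y, z] ↔ v 0 = x ∧ v 1 = y ∧ v 2 = z := by
  simp [funext_iff, Fin.forall_fin_succ]

/-- The derivation identity in coordinates, where `a`, `b`, `c` are the images of the basis vectors:
it is enough to test it on the three pairs of distinct basis vectors. -/
theorem g2IsDeriv_iff (α β γ : ℝ) (D : (Fin 3 → ℝ) →ₗ[ℝ] (Fin 3 → ℝ)) {a b c : Fin 3 → ℝ}
    (ha : D ![1, 0, 0] = a) (hb : D ![0, 1, 0] = b) (hc : D ![0, 0, 1] = c) :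
    g2IsDeriv α β γ D ↔
      (γ * b 0 - β * c 0 = -α * a 2 ∧
        γ * b 1 - β * c 1 = γ * a 0 + γ * b 1 - β * b 2 ∧
        γ * b 2 - β * c 2 = -β * a 0 - β * b 1 - γ * b 2) ∧
      (-β * b 0 - γ * c 0 = α * a 1 ∧
        -β * b 1 - γ * c 1 = -β * a 0 + γ * c 1 - β * c 2 ∧
        -β * b 2 - γ * c 2 = -γ * a 0 - β * c 1 - γ * c 2) ∧
      (α * a 0 = α * (b 1 + c 2) ∧
        α * a 1 = -β * b 0 - γ * c 0 ∧
        α * a 2 = -γ * b 0 + β * c 0) := by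
  have key (v : Fin 3 → ℝ) : D v = v 0 • a + v 1 • b + v 2 • c := by
    rw [linearMap_apply_fin_three, ha, hb, hc]
  constructor
  · intro h
    have h12 := h ![1, 0, 0] ![0, 1, 0]
    have h13 := h ![1, 0, 0] ![0, 0, 1]
    have h23 := h ![0, 1, 0] ![0, 0, 1]
    simp [key, g2bra, funext_iff, Fin.forall_fin_succ] at h12 h13 h23
    obtain ⟨h1, h2, h3⟩ := h12
    obtain ⟨h4, h5, h6⟩ := h13
    obtain ⟨h7, h8, h9⟩ := h23
    refine ⟨⟨?_, ?_, ?_⟩, ⟨?_, ?_, ?_⟩, ⟨?_, ?_, ?_⟩⟩ <;> linarith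
  · rintro ⟨⟨h1, h2, h3⟩, ⟨h4, h5, h6⟩, h7, h8, h9⟩ X Y
    simp only [key, g2bra]
    ext i
    fin_cases i <;> simp
    · linear_combination (X 0 * Y 1 - X 1 * Y 0) * h1 + (X 0 * Y 2 - X 2 * Y 0) * h4 +
        (X 1 * Y 2 - X 2 * Y 1) * h7
    · linear_combination (X 0 * Y 1 - X 1 * Y 0) * h2 + (X 0 * Y 2 - X 2 * Y 0) * h5 +
        (X 1 * Y 2 - X 2 * Y 1) * h8
    · linear_combination (X 0 * Y 1 - X 1 * Y 0) * h3 + (X 0 * Y 2 - X 2 * Y 0) * h6 +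
        (X 1 * Y 2 - X 2 * Y 1) * h9

theorem stmt5 (α β γ : ℝ) (hγ : γ ≠ 0) (D : (Fin 3 → ℝ) →ₗ[ℝ] (Fin 3 → ℝ)) :
    (α ≠ 0 → (g2IsDeriv α β γ D ↔ ∃ q u r : ℝ,
        D ![1, 0, 0] = ![0, -(1 / α) * (γ * u + β * q), (1 / α) * (β * u - γ * q)] ∧
        D ![0, 1, 0] = ![q, r, -(β / γ) * r] ∧
        D ![0, 0, 1] = ![u, -(β / γ) * r, -r])) ∧
    (α = 0 → (g2IsDeriv α β γ D ↔ ∃ p q r s : ℝ,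
        D ![1, 0, 0] = ![0, p, q] ∧
        D ![0, 1, 0] = ![0, r, (β / (2 * γ)) * (s - r)] ∧
        D ![0, 0, 1] = ![0, (β / (2 * γ)) * (s - r), s])) := by
  have hne : β ^ 2 + γ ^ 2 ≠ 0 := by positivity
  constructor
  · intro hα
    constructor
    · intro h
      obtain ⟨⟨h1, h2, h3⟩, ⟨h4, h5, h6⟩, h7, h8, h9⟩ := (g2IsDeriv_iff α β γ D rfl rfl rfl).1 h
      generalize D ![1, 0, 0] = a at *
      generalize D ![0, 1, 0] = b at *
      generalize D ![0, 0, 1] = c at *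
      have ha : a 0 = 0 := (mul_eq_zero.1 (show (β ^ 2 + γ ^ 2) * a 0 = 0 by
        linear_combination (-γ / 2) * h2 + (β / 2) * h3 + (β / 2) * h5 + (γ / 2) * h6)
        ).resolve_left hne
      have hbc : b 1 + c 2 = 0 := by
        rw [ha] at h7
        exact (mul_eq_zero.1 (show α * (b 1 + c 2) = 0 by linarith)).resolve_left hα
      have hb : b 2 = -(β / γ) * b 1 := by
        field_simp
        rw [ha] at h3
        linear_combination h3 / 2 + β / 2 * hbc
      have hc : c 1 = -(β / γ) * b 1 := by
        field_simp
        rw [ha] at h5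
        linear_combination -h5 / 2 + β / 2 * hbc
      refine ⟨b 0, c 0, b 1, (eq_vec_fin_three_iff ..).2 ⟨ha, ?_, ?_⟩,
        (eq_vec_fin_three_iff ..).2 ⟨rfl, rfl, hb⟩, (eq_vec_fin_three_iff ..).2 ⟨rfl, hc, ?_⟩⟩
      · field_simp
        linarith
      · field_simp
        linarith
      · linarith
    · rintro ⟨q, u, r, ha, hb, hc⟩
      rw [g2IsDeriv_iff α β γ D ha hb hc]
      refine ⟨⟨?_, ?_, ?_⟩, ⟨?_, ?_, ?_⟩, ⟨?_, ?_, ?_⟩⟩ <;> simp <;> field_simp <;> ring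
  · rintro rfl
    constructor
    · intro h
      obtain ⟨⟨h1, h2, h3⟩, ⟨h4, h5, h6⟩, -⟩ := (g2IsDeriv_iff 0 β γ D rfl rfl rfl).1 h
      generalize D ![1, 0, 0] = a at *
      generalize D ![0, 1, 0] = b at *
      generalize D ![0, 0, 1] = c at *
      have ha : a 0 = 0 := (mul_eq_zero.1 (show (β ^ 2 + γ ^ 2) * a 0 = 0 by
        linear_combination (-γ / 2) * h2 + (β / 2) * h3 + (β / 2) * h5 + (γ / 2) * h6)
        ).resolve_left hne
      have hb0 : b 0 = 0 := (mul_eq_zero.1 (show (β ^ 2 + γ ^ 2) * b 0 = 0 by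
        linear_combination γ * h1 - β * h4)).resolve_left hne
      have hc0 : c 0 = 0 := (mul_eq_zero.1 (show (β ^ 2 + γ ^ 2) * c 0 = 0 by
        linear_combination -β * h1 - γ * h4)).resolve_left hne
      rw [ha] at h3 h5
      refine ⟨a 1, a 2, b 1, c 2, (eq_vec_fin_three_iff ..).2 ⟨ha, rfl, rfl⟩,
        (eq_vec_fin_three_iff ..).2 ⟨hb0, rfl, ?_⟩, (eq_vec_fin_three_iff ..).2 ⟨hc0, ?_, rfl⟩⟩
      · field_simp
        linarith
      · field_simp
        linarith
    · rintro ⟨p, q, r, s, ha, hb, hc⟩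
      rw [g2IsDeriv_iff 0 β γ D ha hb hc]
      refine ⟨⟨?_, ?_, ?_⟩, ⟨?_, ?_, ?_⟩, ⟨?_, ?_, ?_⟩⟩ <;> simp <;> field_simp <;> ring
end

section
/- There exist a real number c and a derivation D of 𝔤₂ such that Ric = c·Id + D if and only if α = β = 0. Moreover, when α = β = 0 the only such pair is c = −2γ² and D given by D e₁ = 0, D e₂ = 2γ² e₂, D e₃ = 2γ² e₃. -/
/-- The Ricci operator of (G₂, g). -/
noncomputable def g2Ric (α β γ : ℝ) : (Fin 3 → ℝ) →ₗ[ℝ] (Fin 3 → ℝ) :=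
  Matrix.toLin' !![-α ^ 2 / 2 - 2 * γ ^ 2, 0, 0;
                   0, α * (α / 2 - β), γ * (2 * β - α);
                   0, γ * (α - 2 * β), α * (α / 2 - β)]

theorem g2Ric_apply (α β γ : ℝ) (v : Fin 3 → ℝ) :
    g2Ric α β γ v = ![(-α ^ 2 / 2 - 2 * γ ^ 2) * v 0,
      α * (α / 2 - β) * v 1 + γ * (2 * β - α) * v 2,
      γ * (α - 2 * β) * v 1 + α * (α / 2 - β) * v 2] := by
  ext i
  fin_cases i <;> simp [g2Ric, Matrix.mulVec, dotProduct, Fin.sum_univ_three]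

/-- If `Ric - c • id` is a derivation, then `α = β = 0` and `c = -2γ²`. -/
theorem eq_zero_of_g2IsDeriv {α β γ c : ℝ} (hγ : γ ≠ 0)
    {D : (Fin 3 → ℝ) →ₗ[ℝ] (Fin 3 → ℝ)} (hD : g2IsDeriv α β γ D)
    (h : g2Ric α β γ = c • (LinearMap.id : (Fin 3 → ℝ) →ₗ[ℝ] (Fin 3 → ℝ)) + D) :
    α = 0 ∧ β = 0 ∧ c = -2 * γ ^ 2 := by
  obtain rfl : D = g2Ric α β γ - c • LinearMap.id := by rw [h]; abel
  have h₁₂ := hD ![1, 0, 0] ![0, 1, 0]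
  have h₂₃ := hD ![0, 1, 0] ![0, 0, 1]
  have e₁ := congrFun h₁₂ 1
  have e₂ := congrFun h₁₂ 2
  have e₃ := congrFun h₂₃ 0
  simp [g2bra, g2Ric_apply] at e₁ e₂ e₃
  have hA : γ ^ 2 + β ^ 2 ≠ 0 := by positivity
  have ha : -α ^ 2 / 2 - 2 * γ ^ 2 - c = 0 := by
    refine (mul_eq_zero.mp ?_).resolve_right hA
    linear_combination (-γ) * e₁ + β * e₂
  have hm : α - 2 * β = 0 := by
    refine (mul_eq_zero.mp ?_).resolve_right (mul_ne_zero hγ hA)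
    linear_combination β / 2 * e₁ + γ / 2 * e₂
  have hα : α = 0 := by
    have hd : α ^ 2 / 2 + 2 * γ ^ 2 ≠ 0 := by positivity
    refine (mul_eq_zero.mp ?_).resolve_right hd
    linear_combination (-1 / 2) * e₃ - α ^ 2 / 2 * hm - α / 2 * ha
  subst hα
  exact ⟨rfl, by linarith, by linarith⟩

/-- For `α = β = 0`, the endomorphism `Ric + 2γ² • id` is a derivation. -/
theorem g2IsDeriv_g2Ric_add (γ : ℝ) :
    g2IsDeriv 0 0 γ (g2Ric 0 0 γ - (-2 * γ ^ 2) • LinearMap.id) := by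
  intro X Y
  ext i
  fin_cases i <;>
    simp [g2bra, g2Ric_apply] <;> ring

theorem stmt6 (α β γ : ℝ) (hγ : γ ≠ 0) :
    ((∃ (c : ℝ) (D : (Fin 3 → ℝ) →ₗ[ℝ] (Fin 3 → ℝ)), g2IsDeriv α β γ D ∧
        g2Ric α β γ = c • (LinearMap.id : (Fin 3 → ℝ) →ₗ[ℝ] (Fin 3 → ℝ)) + D) ↔
      (α = 0 ∧ β = 0)) ∧
    (α = 0 → β = 0 → ∀ (c : ℝ) (D : (Fin 3 → ℝ) →ₗ[ℝ] (Fin 3 → ℝ)),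
      (g2IsDeriv α β γ D ∧
        g2Ric α β γ = c • (LinearMap.id : (Fin 3 → ℝ) →ₗ[ℝ] (Fin 3 → ℝ)) + D) ↔
      (c = -2 * γ ^ 2 ∧ D ![1, 0, 0] = 0 ∧
        D ![0, 1, 0] = ![0, 2 * γ ^ 2, 0] ∧
        D ![0, 0, 1] = ![0, 0, 2 * γ ^ 2])) := by
  refine ⟨⟨?_, ?_⟩, ?_⟩
  · rintro ⟨c, D, hD, h⟩
    obtain ⟨hα, hβ, -⟩ := eq_zero_of_g2IsDeriv hγ hD h
    exact ⟨hα, hβ⟩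
  · rintro ⟨rfl, rfl⟩
    exact ⟨-2 * γ ^ 2, _, g2IsDeriv_g2Ric_add γ, by abel⟩
  · rintro rfl rfl c D
    constructor
    · rintro ⟨hD, h⟩
      obtain ⟨-, -, rfl⟩ := eq_zero_of_g2IsDeriv hγ hD h
      obtain rfl : D = g2Ric 0 0 γ - (-2 * γ ^ 2) • LinearMap.id := by rw [h]; abel
      refine ⟨rfl, ?_, ?_, ?_⟩ <;> ext i <;> fin_cases i <;>
        simp [g2Ric_apply]
    · rintro ⟨rfl, h₁, h₂, h₃⟩
      have key : D = g2Ric 0 0 γ - (-2 * γ ^ 2) • LinearMap.id := by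
        refine LinearMap.ext fun v => funext fun i => ?_
        have hv : v = v 0 • ![1, 0, 0] + v 1 • ![0, 1, 0] + v 2 • ![0, 0, 1] := by
          ext j; fin_cases j <;> simp
        rw [hv, map_add, map_add, map_smul, map_smul, map_smul, h₁, h₂, h₃]
        fin_cases i <;> simp [g2Ric_apply] <;> ring
      subst key
      exact ⟨g2IsDeriv_g2Ric_add γ, by abel⟩
end

section
/- Suppose α = β = 0. Then the derivation D of 𝔤₂ defined by D e₁ = 0, D e₂ = 2γ² e₂, D e₃ = 2γ² e₃ is an outer derivation: D ≠ ad X for every X ∈ 𝔤₂, where ad X denotes the linear map Y ↦ [X, Y]. -/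
/-- If α = β = 0, the derivation D with D e₁ = 0, D e₂ = 2γ² e₂, D e₃ = 2γ² e₃ is an
outer derivation: D ≠ ad X for every X ∈ 𝔤₂. -/
theorem stmt7 (α β γ : ℝ) (hγ : γ ≠ 0) (hα : α = 0) (hβ : β = 0)
    (D : (Fin 3 → ℝ) →ₗ[ℝ] (Fin 3 → ℝ))
    (h1 : D ![1, 0, 0] = 0)
    (h2 : D ![0, 1, 0] = ![0, 2 * γ ^ 2, 0])
    (h3 : D ![0, 0, 1] = ![0, 0, 2 * γ ^ 2]) :
    g2IsDeriv α β γ D ∧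
      ∀ X : Fin 3 → ℝ, ¬ (∀ Y : Fin 3 → ℝ, D Y = g2bra α β γ X Y) := by
  subst hα hβ
  have hD (Y : Fin 3 → ℝ) : D Y = ![0, 2 * γ ^ 2 * Y 1, 2 * γ ^ 2 * Y 2] := by
    have hY : Y = Y 0 • ![1, 0, 0] + Y 1 • ![0, 1, 0] + Y 2 • ![0, 0, 1] := by
      ext i
      fin_cases i <;> simp
    rw [hY, map_add, map_add, map_smul, map_smul, map_smul, h1, h2, h3]
    ext i
    fin_cases i <;> simp [mul_comm]
  constructor
  · intro X Y
    rw [hD, hD X, hD Y]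
    ext i
    fin_cases i <;> simp [g2bra] <;> ring
  · intro X h
    have e2 := congrFun (h ![0, 1, 0]) 1
    have e3 := congrFun (h ![0, 0, 1]) 2
    simp only [h2, h3, g2bra, Matrix.cons_val] at e2 e3
    have hpos : 0 < γ ^ 2 := by positivity
    linarith
end

section
/- Let D be a linear endomorphism of 𝔤₃. (i) If β = γ = 0 and α ≠ 0: D is a derivation if and only if there exist real numbers q₁, q₂, r, s, t, m with D e₁ = (r + s) e₁, D e₂ = q₁ e₁ + r e₂ + t e₃, D e₃ = q₂ e₁ + m e₂ + s e₃. (ii) If α = β = 0 and γ ≠ 0: D is a derivation if and only if there exist u, v, q, r, t, s with D e₁ = (s − r) e₁ + u e₂ + v e₃, D e₂ = q e₁ + r e₂ + t e₃, D e₃ = s e₃. (iii) If αβγ ≠ 0: D is a derivation if and only if there exist u, v, w with D e₁ = u e₂ + v e₃, D e₂ = −(α/β) u e₁ + w e₃, D e₃ = (α/γ) v e₁ + (β/γ) w e₂. (iv) If γ = 0 and αβ ≠ 0: D is a derivation if and only if there exist p, u, q, r with D e₁ = p e₁ + u e₂, D e₂ = −(α/β) u e₁ + p e₂, D e₃ =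 q e₁ + r e₂. (v) If β = 0 and αγ ≠ 0: D is a derivation if and only if there exist p, v, q, w with D e₁ = p e₁ + v e₃, D e₂ = q e₁ + w e₃, D e₃ = (α/γ) v e₁ + p e₃. (vi) If α = β = γ = 0: every linear endomorphism of 𝔤₃ is a derivation. -/
/-- Bracket of the Lie algebra 𝔤₃ in coordinates w.r.t. the basis {e₁,e₂,e₃}:
[e₁,e₂] = −γ e₃, [e₁,e₃] = −β e₂, [e₂,e₃] = α e₁. -/
noncomputable def g3bra (α β γ : ℝ) (X Y : Fin 3 → ℝ) : Fin 3 → ℝ :=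
  ![(X 1 * Y 2 - X 2 * Y 1) * α,
    -(X 0 * Y 2 - X 2 * Y 0) * β,
    -(X 0 * Y 1 - X 1 * Y 0) * γ]

/-- `D` is a derivation of 𝔤₃. -/
def g3IsDeriv (α β γ : ℝ) (D : (Fin 3 → ℝ) →ₗ[ℝ] (Fin 3 → ℝ)) : Prop :=
  ∀ X Y, D (g3bra α β γ X Y) = g3bra α β γ (D X) Y + g3bra α β γ X (D Y)

/-- `D` is a derivation of 𝔤₃ iff its matrix entries in the basis {e₁,e₂,e₃} satisfy
six bilinear equations. -/
theorem g3IsDeriv_iff_of_apply_basis {α β γ : ℝ} {D : (Fin 3 → ℝ) →ₗ[ℝ] (Fin 3 → ℝ)}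
    {a b c d e f g h i : ℝ} (h₁ : D ![1, 0, 0] = ![a, b, c])
    (h₂ : D ![0, 1, 0] = ![d, e, f]) (h₃ : D ![0, 0, 1] = ![g, h, i]) :
    g3IsDeriv α β γ D ↔ α * c = γ * g ∧ α * b = -(β * d) ∧ β * f = γ * h ∧
      γ * i = γ * (a + e) ∧ β * e = β * (a + i) ∧ α * a = α * (e + i) := by
  have hD (X : Fin 3 → ℝ) : D X = ![X 0 * a + X 1 * d + X 2 * g,
      X 0 * b + X 1 * e + X 2 * h, X 0 * c + X 1 * f + X 2 * i] := by
    have hX : X = X 0 • ![1, 0, 0] + X 1 • ![0, 1, 0] + X 2 • ![0, 0, 1] := by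
      ext j; fin_cases j <;> simp
    conv_lhs => rw [hX, map_add, map_add, map_smul, map_smul, map_smul, h₁, h₂, h₃]
    ext j; fin_cases j <;> simp
  constructor
  · intro H
    have h12 := H ![1, 0, 0] ![0, 1, 0]
    have h13 := H ![1, 0, 0] ![0, 0, 1]
    have h23 := H ![0, 1, 0] ![0, 0, 1]
    simp only [hD, g3bra, funext_iff, Fin.forall_fin_succ] at h12 h13 h23
    simp at h12 h13 h23
    refine ⟨?_, ?_, ?_, ?_, ?_, ?_⟩ <;> linarith
  · rintro ⟨e₁, e₂, e₃, e₄, e₅, e₆⟩ X Y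
    simp only [hD, g3bra]
    ext j; fin_cases j <;> simp
    · linear_combination (X 0 * Y 1 - X 1 * Y 0) * e₁ - (X 0 * Y 2 - X 2 * Y 0) * e₂ +
        (X 1 * Y 2 - X 2 * Y 1) * e₆
    · linear_combination (X 1 * Y 2 - X 2 * Y 1) * e₂ - (X 0 * Y 2 - X 2 * Y 0) * e₅ +
        (X 0 * Y 1 - X 1 * Y 0) * e₃
    · linear_combination (X 1 * Y 2 - X 2 * Y 1) * e₁ - (X 0 * Y 2 - X 2 * Y 0) * e₃ -
        (X 0 * Y 1 - X 1 * Y 0) * e₄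

theorem stmt8 (α β γ : ℝ) (D : (Fin 3 → ℝ) →ₗ[ℝ] (Fin 3 → ℝ)) :
    (β = 0 → γ = 0 → α ≠ 0 → (g3IsDeriv α β γ D ↔ ∃ q₁ q₂ r s t m : ℝ,
        D ![1, 0, 0] = ![r + s, 0, 0] ∧
        D ![0, 1, 0] = ![q₁, r, t] ∧
        D ![0, 0, 1] = ![q₂, m, s])) ∧
    (α = 0 → β = 0 → γ ≠ 0 → (g3IsDeriv α β γ D ↔ ∃ u v q r t s : ℝ,
        D ![1, 0, 0] = ![s - r, u, v] ∧
        D ![0, 1, 0] = ![q, r, t] ∧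
        D ![0, 0, 1] = ![0, 0, s])) ∧
    (α ≠ 0 → β ≠ 0 → γ ≠ 0 → (g3IsDeriv α β γ D ↔ ∃ u v w : ℝ,
        D ![1, 0, 0] = ![0, u, v] ∧
        D ![0, 1, 0] = ![-(α / β) * u, 0, w] ∧
        D ![0, 0, 1] = ![(α / γ) * v, (β / γ) * w, 0])) ∧
    (γ = 0 → α ≠ 0 → β ≠ 0 → (g3IsDeriv α β γ D ↔ ∃ p u q r : ℝ,
        D ![1, 0, 0] = ![p, u, 0] ∧
        D ![0, 1, 0] = ![-(α / β) * u, p, 0] ∧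
        D ![0, 0, 1] = ![q, r, 0])) ∧
    (β = 0 → α ≠ 0 → γ ≠ 0 → (g3IsDeriv α β γ D ↔ ∃ p v q w : ℝ,
        D ![1, 0, 0] = ![p, 0, v] ∧
        D ![0, 1, 0] = ![q, 0, w] ∧
        D ![0, 0, 1] = ![(α / γ) * v, 0, p])) ∧
    (α = 0 → β = 0 → γ = 0 → g3IsDeriv α β γ D) := by
  have eta (v : Fin 3 → ℝ) : v = ![v 0, v 1, v 2] := by
    ext j; fin_cases j <;> rfl
  obtain ⟨a, b, c, h₁⟩ : ∃ a b c, D ![1, 0, 0] = ![a, b, c] := ⟨_, _, _, eta _⟩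
  obtain ⟨d, e, f, h₂⟩ : ∃ d e f, D ![0, 1, 0] = ![d, e, f] := ⟨_, _, _, eta _⟩
  obtain ⟨g, h, i, h₃⟩ : ∃ g h i, D ![0, 0, 1] = ![g, h, i] := ⟨_, _, _, eta _⟩
  have vec_eq (x y z x' y' z' : ℝ) :
      ![x, y, z] = ![x', y', z'] ↔ x = x' ∧ y = y' ∧ z = z' := by
    simp
  simp only [g3IsDeriv_iff_of_apply_basis h₁ h₂ h₃, h₁, h₂, h₃, vec_eq]
  refine ⟨?_, ?_, ?_, ?_, ?_, ?_⟩
  · rintro rfl rfl hα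
    constructor
    · intro H
      exact ⟨d, g, e, i, f, h, by grind⟩
    · grind
  · rintro rfl rfl hγ
    constructor
    · intro H
      exact ⟨b, c, d, e, f, i, by grind⟩
    · grind
  · intro hα hβ hγ
    constructor
    · intro H
      exact ⟨b, c, f, by grind⟩
    · grind
  · rintro rfl hα hβ
    constructor
    · intro H
      exact ⟨a, b, g, h, by grind⟩
    · grind
  · rintro rfl hα hγ
    constructor
    · intro H
      exact ⟨a, c, d, f, by grind⟩
    · grind
  · rintro rfl rfl rfl
    simp
end

section
/- Assume (α, β, γ) satisfies one of the patterns: (a) β = γ = 0; (b) α = β = 0; (c) αβγ ≠ 0; (d) γ = 0 and αβ ≠ 0; (e) β = 0 and αγ ≠ 0. Then there exist a real number c and a derivation D of 𝔤₃ with Ric = c·Id + D if and only if one of the following holds, with a solution (D, c) as indicated (diag(x,y,z) denotes the endomorphism with D e₁ = x e₁, D e₂ = y e₂, D e₃ = z e₃): (1) β = γ = 0 and α ≠ 0, with D = diag(−2α², −α², −α²) and c = 3α²/2; (2) α = β = 0 and γ ≠ 0, with D = diag(−γ², −γ², −2γ²) and c = 3γ²/2; (3) α = β = γ ≠ 0,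 with D = 0 and c = −α²/2 (the metric is Einstein); (4) γ = 0 and β = α ≠ 0, with D = 0 and c = 0; (5) γ = 0 and β = −α ≠ 0, with D = diag(−2α², −2α², 0) and c = 2α²; (6) β = 0 and γ = −α ≠ 0, with D = diag(−2α², 0, −2α²) and c = 2α²; (7) β = 0 and γ = α ≠ 0, with D = 0 and c = 0; (8) α = β = γ = 0, in which case the solutions are exactly D = λ·Id and c = −λ, for λ ∈ ℝ. -/
/-- The diagonal endomorphism with D e₁ = x e₁, D e₂ = y e₂, D e₃ = z e₃. -/
noncomputable def dg (x y z : ℝ) : (Fin 3 → ℝ) →ₗ[ℝ] (Fin 3 → ℝ) :=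
  Matrix.toLin' (Matrix.diagonal ![x, y, z])

/-- The Ricci operator of (G₃, g), with a₁ = (α−β−γ)/2, a₂ = (α−β+γ)/2, a₃ = (α+β−γ)/2. -/
noncomputable def g3Ric (α β γ : ℝ) : (Fin 3 → ℝ) →ₗ[ℝ] (Fin 3 → ℝ) :=
  dg (-((α - β - γ) / 2) * ((α - β + γ) / 2) - ((α - β - γ) / 2) * ((α + β - γ) / 2)
        - β * ((α - β + γ) / 2) - γ * ((α + β - γ) / 2))
     (((α - β + γ) / 2) * ((α + β - γ) / 2) - ((α - β - γ) / 2) * ((α - β + γ) / 2)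
        + α * ((α - β - γ) / 2) - γ * ((α + β - γ) / 2))
     (-((α - β - γ) / 2) * ((α + β - γ) / 2) + ((α - β + γ) / 2) * ((α + β - γ) / 2)
        + α * ((α - β - γ) / 2) - β * ((α - β + γ) / 2))

/-- The algebraic Ricci soliton condition Ric = c·Id + D on 𝔤₃. -/
def g3ARS (α β γ c : ℝ) (D : (Fin 3 → ℝ) →ₗ[ℝ] (Fin 3 → ℝ)) : Prop :=
  g3IsDeriv α β γ D ∧
    g3Ric α β γ = c • (LinearMap.id : (Fin 3 → ℝ) →ₗ[ℝ] (Fin 3 → ℝ)) + D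

theorem dg_apply (x y z : ℝ) (X : Fin 3 → ℝ) : dg x y z X = ![x * X 0, y * X 1, z * X 2] := by
  ext i
  fin_cases i <;> simp [dg, Matrix.mulVec_diagonal]

theorem dg_inj {x y z x' y' z' : ℝ} : dg x y z = dg x' y' z' ↔ x = x' ∧ y = y' ∧ z = z' := by
  simp [dg, Matrix.diagonal_eq_diagonal_iff, Fin.forall_fin_succ]

theorem smul_id_eq_dg (c : ℝ) : c • (LinearMap.id : (Fin 3 → ℝ) →ₗ[ℝ] (Fin 3 → ℝ)) = dg c c c := by
  refine LinearMap.ext fun X => ?_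
  rw [dg_apply]
  ext i
  fin_cases i <;> simp

theorem zero_eq_dg : (0 : (Fin 3 → ℝ) →ₗ[ℝ] (Fin 3 → ℝ)) = dg 0 0 0 := by
  simpa using smul_id_eq_dg 0

theorem dg_add (x y z x' y' z' : ℝ) : dg x y z + dg x' y' z' = dg (x + x') (y + y') (z + z') := by
  refine LinearMap.ext fun X => ?_
  rw [LinearMap.add_apply, dg_apply, dg_apply, dg_apply]
  ext i
  fin_cases i <;> simp [add_mul]

theorem g3IsDeriv_dg (α β γ x y z : ℝ) :
    g3IsDeriv α β γ (dg x y z) ↔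
      α * (x - y - z) = 0 ∧ β * (y - x - z) = 0 ∧ γ * (z - x - y) = 0 := by
  constructor
  · intro h
    have h1 := congrFun (h ![0, 1, 0] ![0, 0, 1]) 0
    have h2 := congrFun (h ![1, 0, 0] ![0, 0, 1]) 1
    have h3 := congrFun (h ![1, 0, 0] ![0, 1, 0]) 2
    simp [dg_apply, g3bra] at h1 h2 h3
    refine ⟨?_, ?_, ?_⟩ <;> linarith
  · rintro ⟨h1, h2, h3⟩ X Y
    simp only [dg_apply, g3bra]
    ext i
    fin_cases i
    · simp
      linear_combination (X 1 * Y 2 - X 2 * Y 1) * h1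
    · simp
      linear_combination -(X 0 * Y 2 - X 2 * Y 0) * h2
    · simp
      linear_combination -(X 0 * Y 1 - X 1 * Y 0) * h3

theorem g3Ric_eq (α β γ : ℝ) :
    g3Ric α β γ = dg (((β - γ) ^ 2 - α ^ 2) / 2) (((α - γ) ^ 2 - β ^ 2) / 2)
      (((α - β) ^ 2 - γ ^ 2) / 2) := by
  rw [g3Ric, dg_inj]
  refine ⟨?_, ?_, ?_⟩ <;> ring

theorem g3ARS_dg (α β γ c x y z : ℝ) :
    g3ARS α β γ c (dg x y z) ↔
      (α * (x - y - z) = 0 ∧ β * (y - x - z) = 0 ∧ γ * (z - x - y) = 0) ∧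
        ((β - γ) ^ 2 - α ^ 2) / 2 = c + x ∧ ((α - γ) ^ 2 - β ^ 2) / 2 = c + y ∧
        ((α - β) ^ 2 - γ ^ 2) / 2 = c + z := by
  rw [g3ARS, g3IsDeriv_dg, g3Ric_eq, smul_id_eq_dg, dg_add, dg_inj]

theorem g3ARS.eq_dg {α β γ c : ℝ} {D : (Fin 3 → ℝ) →ₗ[ℝ] (Fin 3 → ℝ)} (h : g3ARS α β γ c D) :
    D = dg (((β - γ) ^ 2 - α ^ 2) / 2 - c) (((α - γ) ^ 2 - β ^ 2) / 2 - c)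
      (((α - β) ^ 2 - γ ^ 2) / 2 - c) := by
  have h2 := h.2
  rw [g3Ric_eq, smul_id_eq_dg] at h2
  apply add_left_cancel (a := dg c c c)
  rw [← h2, dg_add, dg_inj]
  refine ⟨?_, ?_, ?_⟩ <;> ring

theorem stmt9 (α β γ : ℝ)
    (hpat : (β = 0 ∧ γ = 0) ∨ (α = 0 ∧ β = 0) ∨ (α ≠ 0 ∧ β ≠ 0 ∧ γ ≠ 0) ∨
            (γ = 0 ∧ α ≠ 0 ∧ β ≠ 0) ∨ (β = 0 ∧ α ≠ 0 ∧ γ ≠ 0)) :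
    ((∃ (c : ℝ) (D : (Fin 3 → ℝ) →ₗ[ℝ] (Fin 3 → ℝ)), g3ARS α β γ c D) ↔
      ((β = 0 ∧ γ = 0 ∧ α ≠ 0) ∨ (α = 0 ∧ β = 0 ∧ γ ≠ 0) ∨ (α = β ∧ β = γ ∧ α ≠ 0) ∨
       (γ = 0 ∧ β = α ∧ α ≠ 0) ∨ (γ = 0 ∧ β = -α ∧ α ≠ 0) ∨ (β = 0 ∧ γ = -α ∧ α ≠ 0) ∨
       (β = 0 ∧ γ = α ∧ α ≠ 0) ∨ (α = 0 ∧ β = 0 ∧ γ = 0))) ∧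
    (β = 0 ∧ γ = 0 ∧ α ≠ 0 →
      g3ARS α β γ (3 * α ^ 2 / 2) (dg (-2 * α ^ 2) (-α ^ 2) (-α ^ 2))) ∧
    (α = 0 ∧ β = 0 ∧ γ ≠ 0 →
      g3ARS α β γ (3 * γ ^ 2 / 2) (dg (-γ ^ 2) (-γ ^ 2) (-2 * γ ^ 2))) ∧
    (α = β ∧ β = γ ∧ α ≠ 0 → g3ARS α β γ (-α ^ 2 / 2) 0) ∧
    (γ = 0 ∧ β = α ∧ α ≠ 0 → g3ARS α β γ 0 0) ∧
    (γ = 0 ∧ β = -α ∧ α ≠ 0 →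
      g3ARS α β γ (2 * α ^ 2) (dg (-2 * α ^ 2) (-2 * α ^ 2) 0)) ∧
    (β = 0 ∧ γ = -α ∧ α ≠ 0 →
      g3ARS α β γ (2 * α ^ 2) (dg (-2 * α ^ 2) 0 (-2 * α ^ 2))) ∧
    (β = 0 ∧ γ = α ∧ α ≠ 0 → g3ARS α β γ 0 0) ∧
    (α = 0 ∧ β = 0 ∧ γ = 0 → ∀ (c : ℝ) (D : (Fin 3 → ℝ) →ₗ[ℝ] (Fin 3 → ℝ)),
      g3ARS α β γ c D ↔ ∃ l : ℝ,
        D = l • (LinearMap.id : (Fin 3 → ℝ) →ₗ[ℝ] (Fin 3 → ℝ)) ∧ c = -l) := by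
  have h_onlyα : β = 0 ∧ γ = 0 ∧ α ≠ 0 →
      g3ARS α β γ (3 * α ^ 2 / 2) (dg (-2 * α ^ 2) (-α ^ 2) (-α ^ 2)) := by
    rintro ⟨rfl, rfl, -⟩
    rw [g3ARS_dg]
    refine ⟨⟨?_, ?_, ?_⟩, ?_, ?_, ?_⟩ <;> ring
  have h_onlyγ : α = 0 ∧ β = 0 ∧ γ ≠ 0 →
      g3ARS α β γ (3 * γ ^ 2 / 2) (dg (-γ ^ 2) (-γ ^ 2) (-2 * γ ^ 2)) := by
    rintro ⟨rfl, rfl, -⟩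
    rw [g3ARS_dg]
    refine ⟨⟨?_, ?_, ?_⟩, ?_, ?_, ?_⟩ <;> ring
  have h_einstein : α = β ∧ β = γ ∧ α ≠ 0 → g3ARS α β γ (-α ^ 2 / 2) 0 := by
    rintro ⟨rfl, rfl, -⟩
    rw [zero_eq_dg, g3ARS_dg]
    refine ⟨⟨?_, ?_, ?_⟩, ?_, ?_, ?_⟩ <;> ring
  have h_γ_flat : γ = 0 ∧ β = α ∧ α ≠ 0 → g3ARS α β γ 0 0 := by
    rintro ⟨rfl, rfl, -⟩
    rw [zero_eq_dg, g3ARS_dg]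
    refine ⟨⟨?_, ?_, ?_⟩, ?_, ?_, ?_⟩ <;> ring
  have h_γ_neg : γ = 0 ∧ β = -α ∧ α ≠ 0 →
      g3ARS α β γ (2 * α ^ 2) (dg (-2 * α ^ 2) (-2 * α ^ 2) 0) := by
    rintro ⟨rfl, rfl, -⟩
    rw [g3ARS_dg]
    refine ⟨⟨?_, ?_, ?_⟩, ?_, ?_, ?_⟩ <;> ring
  have h_β_neg : β = 0 ∧ γ = -α ∧ α ≠ 0 →
      g3ARS α β γ (2 * α ^ 2) (dg (-2 * α ^ 2) 0 (-2 * α ^ 2)) := by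
    rintro ⟨rfl, rfl, -⟩
    rw [g3ARS_dg]
    refine ⟨⟨?_, ?_, ?_⟩, ?_, ?_, ?_⟩ <;> ring
  have h_β_flat : β = 0 ∧ γ = α ∧ α ≠ 0 → g3ARS α β γ 0 0 := by
    rintro ⟨rfl, rfl, -⟩
    rw [zero_eq_dg, g3ARS_dg]
    refine ⟨⟨?_, ?_, ?_⟩, ?_, ?_, ?_⟩ <;> ring
  have h_abelian : α = 0 ∧ β = 0 ∧ γ = 0 → ∀ (c : ℝ) (D : (Fin 3 → ℝ) →ₗ[ℝ] (Fin 3 → ℝ)),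
      g3ARS α β γ c D ↔ ∃ l : ℝ,
        D = l • (LinearMap.id : (Fin 3 → ℝ) →ₗ[ℝ] (Fin 3 → ℝ)) ∧ c = -l := by
    rintro ⟨rfl, rfl, rfl⟩ c D
    constructor
    · intro h
      refine ⟨-c, ?_, by ring⟩
      rw [h.eq_dg, smul_id_eq_dg, dg_inj]
      refine ⟨?_, ?_, ?_⟩ <;> ring
    · rintro ⟨l, rfl, rfl⟩
      rw [smul_id_eq_dg, g3ARS_dg]
      refine ⟨⟨?_, ?_, ?_⟩, ?_, ?_, ?_⟩ <;> ring
  refine ⟨⟨?_, ?_⟩, h_onlyα, h_onlyγ, h_einstein, h_γ_flat, h_γ_neg, h_β_neg, h_β_flat, h_abelian⟩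
  · rintro ⟨c, D, h⟩
    rw [h.eq_dg, g3ARS_dg] at h
    obtain ⟨⟨e1, e2, e3⟩, -⟩ := h
    rcases hpat with ⟨hb, hc⟩ | ⟨ha, hb⟩ | ⟨ha, hb, hc⟩ | ⟨hc, ha, hb⟩ | ⟨hb, ha, hc⟩
    · by_cases ha : α = 0 <;> simp [ha, hb, hc]
    · by_cases hc : γ = 0 <;> simp [ha, hb, hc]
    · have f1 := (mul_eq_zero.mp e1).resolve_left ha
      have f2 := (mul_eq_zero.mp e2).resolve_left hb
      have f3 := (mul_eq_zero.mp e3).resolve_left hc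
      have g1 : (α - β) * (α + β - γ) = 0 := by linarith
      have g2 : (β - γ) * (β + γ - α) = 0 := by linarith
      have g3 : (α - γ) * (α + γ - β) = 0 := by linarith
      have : α = β ∧ β = γ := by grind
      exact Or.inr (Or.inr (Or.inl ⟨this.1, this.2, ha⟩))
    · subst hc
      have f1 := (mul_eq_zero.mp e1).resolve_left ha
      have f2 := (mul_eq_zero.mp e2).resolve_left hb
      rcases sq_eq_sq_iff_eq_or_eq_neg.mp (show β ^ 2 = α ^ 2 by linarith) with h | h
      · exact Or.inr (Or.inr (Or.inr (Or.inl ⟨rfl, h, ha⟩)))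
      · exact Or.inr (Or.inr (Or.inr (Or.inr (Or.inl ⟨rfl, h, ha⟩))))
    · subst hb
      have f1 := (mul_eq_zero.mp e1).resolve_left ha
      have f3 := (mul_eq_zero.mp e3).resolve_left hc
      rcases sq_eq_sq_iff_eq_or_eq_neg.mp (show γ ^ 2 = α ^ 2 by linarith) with h | h
      · exact Or.inr (Or.inr (Or.inr (Or.inr (Or.inr (Or.inr (Or.inl ⟨rfl, h, ha⟩))))))
      · exact Or.inr (Or.inr (Or.inr (Or.inr (Or.inr (Or.inl ⟨rfl, h, ha⟩)))))
  · rintro (h | h | h | h | h | h | h | h)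
    exacts [⟨_, _, h_onlyα h⟩, ⟨_, _, h_onlyγ h⟩, ⟨_, _, h_einstein h⟩, ⟨_, _, h_γ_flat h⟩, ⟨_, _, h_γ_neg h⟩, ⟨_, _, h_β_neg h⟩,
      ⟨_, _, h_β_flat h⟩, ⟨_, _, (h_abelian h 0 0).mpr ⟨0, by simp⟩⟩]
end

section
/- There exist a real number c and a derivation D of 𝔤₄ such that Ric = c·Id + D if and only if α = 0 and β = η. Moreover, in that case Ric = 0 and the only such pair is D = 0 and c = 0. -/
/-- Bracket of the Lie algebra 𝔤₄ in coordinates w.r.t. the basis {e₁,e₂,e₃}: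
[e₁,e₂] = −e₂ + (2η−β) e₃, [e₁,e₃] = −β e₂ + e₃, [e₂,e₃] = α e₁. -/
noncomputable def g4bra (η α β : ℝ) (X Y : Fin 3 → ℝ) : Fin 3 → ℝ :=
  ![(X 1 * Y 2 - X 2 * Y 1) * α,
    -(X 0 * Y 1 - X 1 * Y 0) - (X 0 * Y 2 - X 2 * Y 0) * β,
    (X 0 * Y 1 - X 1 * Y 0) * (2 * η - β) + (X 0 * Y 2 - X 2 * Y 0)]

/-- `D` is a derivation of 𝔤₄. -/
def g4IsDeriv (η α β : ℝ) (D : (Fin 3 → ℝ) →ₗ[ℝ] (Fin 3 → ℝ)) : Prop :=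
  ∀ X Y, D (g4bra η α β X Y) = g4bra η α β (D X) Y + g4bra η α β X (D Y)

/-- The Ricci operator of (G₄, g). -/
noncomputable def g4Ric (η α β : ℝ) : (Fin 3 → ℝ) →ₗ[ℝ] (Fin 3 → ℝ) :=
  Matrix.toLin' !![-α ^ 2 / 2, 0, 0;
                   0, α ^ 2 / 2 + 2 * η * (α - β) - α * β + 2, α + 2 * η - 2 * β;
                   0, -α - 2 * η + 2 * β, α ^ 2 / 2 - α * β - 2 + 2 * η * β]

/-- The derivation identities for `g4Ric - c` on pairs of basis vectors,
written out in coordinates. -/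
lemma g4_deriv_equations {η α β c : ℝ} {D : (Fin 3 → ℝ) →ₗ[ℝ] (Fin 3 → ℝ)}
    (hD : g4IsDeriv η α β D)
    (hR : g4Ric η α β = c • (LinearMap.id : (Fin 3 → ℝ) →ₗ[ℝ] (Fin 3 → ℝ)) + D) :
    let a := -α ^ 2 / 2 - c
    let p := α ^ 2 / 2 + 2 * η * (α - β) - α * β + 2 - c
    let q := α + 2 * η - 2 * β
    let s := α ^ 2 / 2 - α * β - 2 + 2 * η * β - c
    α * a = α * (p + s) ∧
      -p + (2 * η - β) * q = -a - p + β * q ∧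
      q + (2 * η - β) * s = (2 * η - β) * a + (2 * η - β) * p - q ∧
      -β * p + q = -β * a - q - β * s ∧
      β * q + s = a + (2 * η - β) * q + s := by
  have hDv (v : Fin 3 → ℝ) : D v = g4Ric η α β v - c • v := by
    simp [hR]
  have h12 := hD ![1, 0, 0] ![0, 1, 0]
  have h13 := hD ![1, 0, 0] ![0, 0, 1]
  have h23 := hD ![0, 1, 0] ![0, 0, 1]
  simp only [hDv, g4Ric, g4bra, Matrix.toLin'_apply, funext_iff, Fin.forall_fin_succ] at h12 h13 h23
  simp at h12 h13 h23
  refine ⟨?_, ?_, ?_, ?_, ?_⟩ <;> linarith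

lemma g4Ric_self {η : ℝ} (hη : η ^ 2 = 1) : g4Ric η 0 η = 0 := by
  have h1 : 2 * η * (0 - η) + 2 = 0 := by linear_combination -2 * hη
  have h2 : -2 + 2 * η * η = 0 := by linear_combination 2 * hη
  unfold g4Ric
  rw [LinearEquiv.map_eq_zero_iff]
  ext i j
  fin_cases i <;> fin_cases j <;> simp <;> linarith

lemma g4_soliton_params {η α β c : ℝ} {D : (Fin 3 → ℝ) →ₗ[ℝ] (Fin 3 → ℝ)}
    (hη : η ^ 2 = 1) (hD : g4IsDeriv η α β D)
    (hR : g4Ric η α β = c • (LinearMap.id : (Fin 3 → ℝ) →ₗ[ℝ] (Fin 3 → ℝ)) + D) :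
    α = 0 ∧ β = η := by
  obtain ⟨e1, e2, e3, e4, e5⟩ := g4_deriv_equations hD hR
  have hq : (α + 2 * η - 2 * β) * (β - η) ^ 2 = 0 := by
    linear_combination (-β / 2) * e2 + e4 / 2 + (α + 2 * η - 2 * β) * hη - 2 * β * hη
  by_cases hβ : β = η
  · subst hβ
    have hα : α ^ 3 = 0 := by
      have hc : c = -α ^ 2 / 2 := by linarith
      subst hc
      linear_combination -e1 / 2
    exact ⟨pow_eq_zero_iff (by norm_num) |>.mp hα, rfl⟩
  · exfalso
    have hq0 : α + 2 * η - 2 * β = 0 :=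
      (mul_eq_zero.mp hq).resolve_right (pow_ne_zero 2 (sub_ne_zero.mpr hβ))
    obtain rfl : α = 2 * β - 2 * η := by linarith
    have hc : c = -(2 * β - 2 * η) ^ 2 / 2 := by
      linear_combination e5
    subst hc
    have h3 : (β - η) ^ 3 = 0 := by
      linear_combination -e1 / 8
    exact pow_ne_zero 3 (sub_ne_zero.mpr hβ) h3

theorem stmt11 (η α β : ℝ) (hη : η = 1 ∨ η = -1) :
    ((∃ (c : ℝ) (D : (Fin 3 → ℝ) →ₗ[ℝ] (Fin 3 → ℝ)), g4IsDeriv η α β D ∧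
        g4Ric η α β = c • (LinearMap.id : (Fin 3 → ℝ) →ₗ[ℝ] (Fin 3 → ℝ)) + D) ↔
      (α = 0 ∧ β = η)) ∧
    (α = 0 → β = η → g4Ric η α β = 0 ∧
      ∀ (c : ℝ) (D : (Fin 3 → ℝ) →ₗ[ℝ] (Fin 3 → ℝ)),
        (g4IsDeriv η α β D ∧
          g4Ric η α β = c • (LinearMap.id : (Fin 3 → ℝ) →ₗ[ℝ] (Fin 3 → ℝ)) + D) ↔
        (D = 0 ∧ c = 0)) := by
  have hsq : η ^ 2 = 1 := by rcases hη with rfl | rfl <;> norm_num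
  refine ⟨⟨fun ⟨c, D, hD, hR⟩ => g4_soliton_params hsq hD hR, ?_⟩, ?_⟩
  · rintro ⟨rfl, rfl⟩
    refine ⟨0, 0, fun X Y => ?_, by simp [g4Ric_self hsq]⟩
    ext i
    fin_cases i <;> simp [g4bra]
  · rintro rfl rfl
    refine ⟨g4Ric_self hsq, fun c D => ⟨fun ⟨hD, hR⟩ => ?_, ?_⟩⟩
    · obtain ⟨-, h, -⟩ := g4_deriv_equations hD hR
      have hc : c = 0 := by linarith
      rw [g4Ric_self hsq, hc] at hR
      exact ⟨by simpa using hR.symm, hc⟩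
    · rintro ⟨rfl, rfl⟩
      refine ⟨fun X Y => ?_, by simp [g4Ric_self hsq]⟩
      ext i
      fin_cases i <;> simp [g4bra]
end

section
/- Suppose α ≠ 0 and β = α + η. Then for every s ∈ ℝ, the pair Y = −(ηα/2) e₁ + s e₂ − η s e₃ and c = −α²/2 satisfies ρ = c·g + L_Y g; nevertheless there exist no real number c and derivation D of 𝔤₄ with Ric = c·Id + D. Thus the left-invariant Lorentzian metric on the Lie group with Lie algebra 𝔤₄ (which is SL(2,ℝ) in this case) is an expanding Ricci soliton which is not an algebraic Ricci soliton. -/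
/-- The Lie derivative of g along the left-invariant vector field determined by Y. -/
noncomputable def g4lie (η α β : ℝ) (Y X Z : Fin 3 → ℝ) : ℝ :=
  -lmet (g4bra η α β Y X) Z - lmet X (g4bra η α β Y Z)

/-- For α ≠ 0 and β = α + η, (G₄,g) is a (non-algebraic) expanding Ricci soliton with
Y = −(ηα/2) e₁ + s e₂ − η s e₃ and c = −α²/2, for every s ∈ ℝ. -/
theorem stmt12 (η α β : ℝ) (hη : η = 1 ∨ η = -1) (hα : α ≠ 0) (hβ : β = α + η) :
    (∀ s : ℝ, ∀ X Z : Fin 3 → ℝ,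
      lmet (g4Ric η α β X) Z =
        (-α ^ 2 / 2) * lmet X Z + g4lie η α β ![-(η * α) / 2, s, -η * s] X Z) ∧
    ¬ ∃ (c : ℝ) (D : (Fin 3 → ℝ) →ₗ[ℝ] (Fin 3 → ℝ)), g4IsDeriv η α β D ∧
        g4Ric η α β = c • (LinearMap.id : (Fin 3 → ℝ) →ₗ[ℝ] (Fin 3 → ℝ)) + D := by
  subst hβ
  constructor
  · intro s X Z
    simp [lmet, g4lie, g4bra, g4Ric, Matrix.mulVec, dotProduct, Fin.sum_univ_three]
    rcases hη with rfl | rfl <;> ring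
  · rintro ⟨c, D, hD, h⟩
    obtain rfl : D = g4Ric η α (α + η) - c • LinearMap.id := eq_sub_of_add_eq' h.symm
    have h₀ := congrFun (hD ![0, 1, 0] ![0, 0, 1]) 0
    have h₁ := congrFun (hD ![1, 0, 0] ![0, 1, 0]) 1
    simp [g4bra, g4Ric] at h₀ h₁
    have hc : c = -α ^ 2 / 2 := by
      apply mul_left_cancel₀ hα
      linear_combination h₀
    subst hc
    have h₂ : α ^ 2 = 0 := by
      rcases hη with rfl | rfl <;> nlinarith [h₁]
    exact hα ((pow_eq_zero_iff two_ne_zero).mp h₂)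
end

section
/- Let D be a linear endomorphism of 𝔤₅. (i) If (β, γ) ≠ (0, 0): D is a derivation if and only if there exist real numbers p, k, u, v with D e₁ = p e₁ + β k e₂, D e₂ = γ k e₁ + (p + (δ − α) k) e₂, D e₃ = u e₁ + v e₂. (ii) If (β, γ) = (0, 0) and δ ≠ α: D is a derivation if and only if there exist p, r, u, v with D e₁ = p e₁, D e₂ = r e₂, D e₃ = u e₁ + v e₂. (iii) If (β, γ) = (0, 0) and δ = α: D is a derivation if and only if the image of D is contained in the span of e₁ and e₂. -/
/-- Bracket of the Lie algebra 𝔤₅ in coordinates w.r.t. the basis {e₁,e₂,e₃}: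
[e₁,e₂] = 0, [e₁,e₃] = α e₁ + β e₂, [e₂,e₃] = γ e₁ + δ e₂. -/
noncomputable def g5bra (α β γ δ : ℝ) (X Y : Fin 3 → ℝ) : Fin 3 → ℝ :=
  ![(X 0 * Y 2 - X 2 * Y 0) * α + (X 1 * Y 2 - X 2 * Y 1) * γ,
    (X 0 * Y 2 - X 2 * Y 0) * β + (X 1 * Y 2 - X 2 * Y 1) * δ,
    0]

/-- `D` is a derivation of 𝔤₅. -/
def g5IsDeriv (α β γ δ : ℝ) (D : (Fin 3 → ℝ) →ₗ[ℝ] (Fin 3 → ℝ)) : Prop :=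
  ∀ X Y, D (g5bra α β γ δ X Y) = g5bra α β γ δ (D X) Y + g5bra α β γ δ X (D Y)

theorem g5_map_apply (D : (Fin 3 → ℝ) →ₗ[ℝ] (Fin 3 → ℝ)) (X : Fin 3 → ℝ) (i : Fin 3) :
    D X i = X 0 * D ![1, 0, 0] i + X 1 * D ![0, 1, 0] i + X 2 * D ![0, 0, 1] i := by
  have hX : X = X 0 • ![1, 0, 0] + X 1 • ![0, 1, 0] + X 2 • ![0, 0, 1] := by
    ext j
    fin_cases j <;> simp
  conv_lhs => rw [hX]
  simp only [map_add, map_smul, Pi.add_apply, Pi.smul_apply, smul_eq_mul]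

theorem g5_vec_eq_iff (x : Fin 3 → ℝ) (a b c : ℝ) :
    x = ![a, b, c] ↔ x 0 = a ∧ x 1 = b ∧ x 2 = c := by
  simp [funext_iff, Fin.forall_fin_succ]

/-- A third row that kills the derived algebra and respects `[e₁, e₂] = 0` vanishes on `e₁, e₂`. -/
theorem g5_third_row_eq_zero {α β γ δ c d : ℝ} (h1 : α + δ ≠ 0)
    (h3 : α * c + β * d = 0) (h4 : γ * c + δ * d = 0)
    (h5 : d * α = c * γ) (h6 : d * β = c * δ) : c = 0 ∧ d = 0 := by
  have hc : c * (α + δ) ^ 2 = 0 := by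
    linear_combination α * h3 - (2 * α + δ) * h6 + β * h4 + β * h5
  have hd : d * (α + δ) ^ 2 = 0 := by
    linear_combination δ * h4 + (2 * δ + α) * h5 + γ * h3 - γ * h6
  exact ⟨by simpa [h1] using hc, by simpa [h1] using hd⟩

/-- A linear map is a derivation of `𝔤₅` iff its image lies in the span of `e₁, e₂` and its
restriction to that span commutes with the bracket by `e₃`. -/
theorem g5IsDeriv_iff {α β γ δ : ℝ} (h1 : α + δ ≠ 0)
    (D : (Fin 3 → ℝ) →ₗ[ℝ] (Fin 3 → ℝ)) :
    g5IsDeriv α β γ δ D ↔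
      (D ![1, 0, 0] 2 = 0 ∧ D ![0, 1, 0] 2 = 0 ∧ D ![0, 0, 1] 2 = 0) ∧
      D ![1, 0, 0] 1 * γ = D ![0, 1, 0] 0 * β ∧
      β * (D ![0, 1, 0] 1 - D ![1, 0, 0] 0) = D ![1, 0, 0] 1 * (δ - α) ∧
      γ * (D ![0, 1, 0] 1 - D ![1, 0, 0] 0) = D ![0, 1, 0] 0 * (δ - α) := by
  constructor
  · intro h
    have e12 := h ![1, 0, 0] ![0, 1, 0]
    have e13 := h ![1, 0, 0] ![0, 0, 1]
    have e23 := h ![0, 1, 0] ![0, 0, 1]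
    simp only [funext_iff, Fin.forall_fin_succ, g5_map_apply D (g5bra _ _ _ _ _ _)]
      at e12 e13 e23
    simp [g5bra] at e12 e13 e23
    obtain ⟨e12a, e12b⟩ := e12
    obtain ⟨e13a, e13b, e13c⟩ := e13
    obtain ⟨e23a, e23b, e23c⟩ := e23
    obtain ⟨hc, hd⟩ := g5_third_row_eq_zero (c := D ![1, 0, 0] 2) (d := D ![0, 1, 0] 2) h1
      e13c e23c (by linarith) (by linarith)
    have he : D ![0, 0, 1] 2 = 0 := by
      have : D ![0, 0, 1] 2 * (α + δ) = 0 := by linarith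
      simpa [h1] using this
    simp only [he] at e13a e13b e23a e23b
    exact ⟨⟨hc, hd, he⟩, by linarith, by linarith, by linarith⟩
  · rintro ⟨⟨hc, hd, he⟩, h3, h4, h5⟩ X Y
    ext i
    rw [g5_map_apply D (g5bra _ _ _ _ _ _) i]
    fin_cases i
    all_goals
      simp [g5bra, g5_map_apply D X, g5_map_apply D Y, hc, hd, he]
    · linear_combination (-(X 0 * Y 2 - X 2 * Y 0)) * h3 - (X 1 * Y 2 - X 2 * Y 1) * h5
    · linear_combination (X 0 * Y 2 - X 2 * Y 0) * h4 + (X 1 * Y 2 - X 2 * Y 1) * h3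

theorem g5_mem_span_iff (x : Fin 3 → ℝ) :
    x ∈ Submodule.span ℝ {(![1, 0, 0] : Fin 3 → ℝ), (![0, 1, 0] : Fin 3 → ℝ)} ↔ x 2 = 0 := by
  rw [Submodule.mem_span_pair]
  constructor
  · rintro ⟨a, b, rfl⟩
    simp
  · intro hx
    refine ⟨x 0, x 1, ?_⟩
    ext j
    fin_cases j <;> simp [hx]

theorem g5_range_le_iff (D : (Fin 3 → ℝ) →ₗ[ℝ] (Fin 3 → ℝ)) :
    LinearMap.range D ≤ Submodule.span ℝ
        {(![1, 0, 0] : Fin 3 → ℝ), (![0, 1, 0] : Fin 3 → ℝ)} ↔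
      D ![1, 0, 0] 2 = 0 ∧ D ![0, 1, 0] 2 = 0 ∧ D ![0, 0, 1] 2 = 0 := by
  constructor
  · intro h
    have key (X) : D X 2 = 0 := (g5_mem_span_iff _).1 (h ⟨X, rfl⟩)
    exact ⟨key _, key _, key _⟩
  · rintro ⟨hc, hd, he⟩ _ ⟨X, rfl⟩
    rw [g5_mem_span_iff, g5_map_apply, hc, hd, he]
    ring

theorem stmt13 (α β γ δ : ℝ) (h1 : α + δ ≠ 0) (h2 : α * γ + β * δ = 0)
    (D : (Fin 3 → ℝ) →ₗ[ℝ] (Fin 3 → ℝ)) :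
    (¬(β = 0 ∧ γ = 0) → (g5IsDeriv α β γ δ D ↔ ∃ p k u v : ℝ,
        D ![1, 0, 0] = ![p, β * k, 0] ∧
        D ![0, 1, 0] = ![γ * k, p + (δ - α) * k, 0] ∧
        D ![0, 0, 1] = ![u, v, 0])) ∧
    (β = 0 → γ = 0 → δ ≠ α → (g5IsDeriv α β γ δ D ↔ ∃ p r u v : ℝ,
        D ![1, 0, 0] = ![p, 0, 0] ∧
        D ![0, 1, 0] = ![0, r, 0] ∧
        D ![0, 0, 1] = ![u, v, 0])) ∧
    (β = 0 → γ = 0 → δ = α → (g5IsDeriv α β γ δ D ↔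
        LinearMap.range D ≤ Submodule.span ℝ
          {(![1, 0, 0] : Fin 3 → ℝ), (![0, 1, 0] : Fin 3 → ℝ)})) := by
  rw [g5IsDeriv_iff h1 D, g5_range_le_iff]
  simp only [g5_vec_eq_iff]
  refine ⟨fun hne => ⟨?_, ?_⟩, ?_, ?_⟩
  · rintro ⟨⟨hc, hd, he⟩, h3, h4, h5⟩
    by_cases hβ : β = 0
    · have hγ : γ ≠ 0 := fun hγ => hne ⟨hβ, hγ⟩
      subst hβ
      refine ⟨_, D ![0, 1, 0] 0 / γ, _, _, ⟨rfl, ?_, hc⟩, ⟨?_, ?_, hd⟩, rfl, rfl, he⟩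
      · simpa [hγ] using h3
      · field_simp
      · field_simp
        linarith
    · refine ⟨_, D ![1, 0, 0] 1 / β, _, _, ⟨rfl, ?_, hc⟩, ⟨?_, ?_, hd⟩, rfl, rfl, he⟩
      · field_simp
      · field_simp
        linarith
      · field_simp
        linarith
  · rintro ⟨p, k, u, v, ⟨ha, hb, hc⟩, ⟨ha', hb', hd⟩, -, -, he⟩
    refine ⟨⟨hc, hd, he⟩, ?_, ?_, ?_⟩
    · rw [hb, ha']; ring
    · rw [hb', ha, hb]; ring
    · rw [hb', ha, ha']; ring
  · rintro rfl rfl hδ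
    have hδ' : δ - α ≠ 0 := sub_ne_zero.2 hδ
    constructor
    · rintro ⟨⟨hc, hd, he⟩, -, h4, h5⟩
      exact ⟨_, _, _, _, ⟨rfl, by simpa [hδ'] using h4, hc⟩, ⟨by simpa [hδ'] using h5, rfl, hd⟩,
        rfl, rfl, he⟩
    · rintro ⟨p, r, u, v, ⟨-, hb, hc⟩, ⟨ha', -, hd⟩, -, -, he⟩
      simp [hc, hd, he, hb, ha']
  · rintro rfl rfl rfl
    simp
end

section
/- There exist a real number c and a derivation D of 𝔤₆ such that Ric = c·Id + D if and only if either (β, γ) ≠ (0, 0) and α² − β² = δ² − γ², or (β, γ) = (0, 0). Moreover, in the first case the unique such pair is c = −α² − δ² + (β − γ)²/2 and D given by D e₁ = 0, D e₂ = (α² − β² + βγ − αδ) e₂, D e₃ = (α² − β² + βγ − αδ) e₃; in the second case the unique such pair is c = −(α² + δ²) and D given by D e₁ = 0, D e₂ = δ(δ − α) e₂, D e₃ = α(α − δ) e₃. -/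
/-- Bracket of the Lie algebra 𝔤₆ in coordinates w.r.t. the basis {e₁,e₂,e₃}:
[e₁,e₂] = α e₂ + β e₃, [e₁,e₃] = γ e₂ + δ e₃, [e₂,e₃] = 0. -/
noncomputable def g6bra (α β γ δ : ℝ) (X Y : Fin 3 → ℝ) : Fin 3 → ℝ :=
  ![0,
    (X 0 * Y 1 - X 1 * Y 0) * α + (X 0 * Y 2 - X 2 * Y 0) * γ,
    (X 0 * Y 1 - X 1 * Y 0) * β + (X 0 * Y 2 - X 2 * Y 0) * δ]

/-- `D` is a derivation of 𝔤₆. -/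
def g6IsDeriv (α β γ δ : ℝ) (D : (Fin 3 → ℝ) →ₗ[ℝ] (Fin 3 → ℝ)) : Prop :=
  ∀ X Y, D (g6bra α β γ δ X Y) = g6bra α β γ δ (D X) Y + g6bra α β γ δ X (D Y)

/-- The Ricci operator of (G₆, g). -/
noncomputable def g6Ric (α β γ δ : ℝ) : (Fin 3 → ℝ) →ₗ[ℝ] (Fin 3 → ℝ) :=
  Matrix.toLin' (Matrix.diagonal
    ![-α ^ 2 - δ ^ 2 + (β - γ) ^ 2 / 2,
      -α ^ 2 - α * δ + (β ^ 2 - γ ^ 2) / 2,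
      -δ ^ 2 - α * δ - (β ^ 2 - γ ^ 2) / 2])

theorem eq_diagonal_iff (D : (Fin 3 → ℝ) →ₗ[ℝ] (Fin 3 → ℝ)) (a b c : ℝ) :
    D = Matrix.toLin' (Matrix.diagonal ![a, b, c]) ↔
      D ![1, 0, 0] = a • (![1, 0, 0] : Fin 3 → ℝ) ∧
      D ![0, 1, 0] = b • (![0, 1, 0] : Fin 3 → ℝ) ∧
      D ![0, 0, 1] = c • (![0, 0, 1] : Fin 3 → ℝ) := by
  constructor
  · rintro rfl
    refine ⟨?_, ?_, ?_⟩ <;> ext i <;> fin_cases i <;> simp [Matrix.mulVec_diagonal]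
  · rintro ⟨ha, hb, hc⟩
    refine LinearMap.ext fun X => ?_
    have hX : X = X 0 • ![1, 0, 0] + X 1 • ![0, 1, 0] + X 2 • ![0, 0, 1] := by
      ext i; fin_cases i <;> simp
    conv_lhs => rw [hX]
    simp only [map_add, map_smul, ha, hb, hc]
    ext i
    fin_cases i <;> simp [Matrix.mulVec_diagonal, mul_comm]

theorem g6IsDeriv_diagonal_iff (α β γ δ : ℝ) (h1 : α + δ ≠ 0) (a b c : ℝ) :
    g6IsDeriv α β γ δ (Matrix.toLin' (Matrix.diagonal ![a, b, c])) ↔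
      a = 0 ∧ (β = 0 ∧ γ = 0 ∨ b = c) := by
  constructor
  · intro h
    have h₂ := h ![1, 0, 0] ![0, 1, 0]
    have h₃ := h ![1, 0, 0] ![0, 0, 1]
    have h₂₁ := congrFun h₂ 1
    have h₂₂ := congrFun h₂ 2
    have h₃₁ := congrFun h₃ 1
    have h₃₂ := congrFun h₃ 2
    simp [g6bra, Matrix.mulVec_diagonal, -mul_eq_mul_right_iff, -mul_eq_mul_left_iff]
      at h₂₁ h₂₂ h₃₁ h₃₂
    have ha : a = 0 := by grind
    subst ha
    refine ⟨rfl, or_iff_not_imp_right.mpr fun hbc => ?_⟩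
    have hbc' := sub_ne_zero.mpr hbc
    exact ⟨(mul_eq_zero.mp (by linarith : β * (b - c) = 0)).resolve_right hbc',
      (mul_eq_zero.mp (by linarith : γ * (b - c) = 0)).resolve_right hbc'⟩
  · rintro ⟨rfl, ⟨rfl, rfl⟩ | rfl⟩ X Y <;> ext i <;> fin_cases i <;>
      simp [g6bra, Matrix.mulVec_diagonal] <;> ring

/-- For the Ricci operator, the soliton equation determines `c` and `D` completely. -/
theorem g6_soliton_iff (α β γ δ : ℝ) (h1 : α + δ ≠ 0) (c : ℝ)
    (D : (Fin 3 → ℝ) →ₗ[ℝ] (Fin 3 → ℝ)) :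
    (g6IsDeriv α β γ δ D ∧
        g6Ric α β γ δ = c • (LinearMap.id : (Fin 3 → ℝ) →ₗ[ℝ] (Fin 3 → ℝ)) + D) ↔
      (β = 0 ∧ γ = 0 ∨ α ^ 2 - β ^ 2 = δ ^ 2 - γ ^ 2) ∧
      c = -α ^ 2 - δ ^ 2 + (β - γ) ^ 2 / 2 ∧
      D = Matrix.toLin' (Matrix.diagonal
        ![0, δ ^ 2 - γ ^ 2 + β * γ - α * δ, α ^ 2 - β ^ 2 + β * γ - α * δ]) := by
  have hD : g6Ric α β γ δ = c • (LinearMap.id : (Fin 3 → ℝ) →ₗ[ℝ] (Fin 3 → ℝ)) + D ↔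
      D = Matrix.toLin' (Matrix.diagonal
        ![-α ^ 2 - δ ^ 2 + (β - γ) ^ 2 / 2 - c,
          -α ^ 2 - α * δ + (β ^ 2 - γ ^ 2) / 2 - c,
          -δ ^ 2 - α * δ - (β ^ 2 - γ ^ 2) / 2 - c]) := by
    rw [← sub_eq_iff_eq_add', eq_comm]
    suffices h : g6Ric α β γ δ - c • LinearMap.id = Matrix.toLin' (Matrix.diagonal
        ![-α ^ 2 - δ ^ 2 + (β - γ) ^ 2 / 2 - c,
          -α ^ 2 - α * δ + (β ^ 2 - γ ^ 2) / 2 - c,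
          -δ ^ 2 - α * δ - (β ^ 2 - γ ^ 2) / 2 - c]) by rw [h]
    refine LinearMap.ext fun X => ?_
    ext i
    fin_cases i <;> simp [g6Ric, Matrix.mulVec_diagonal] <;> ring
  have hr₂ : -α ^ 2 - α * δ + (β ^ 2 - γ ^ 2) / 2 - (-α ^ 2 - δ ^ 2 + (β - γ) ^ 2 / 2) =
      δ ^ 2 - γ ^ 2 + β * γ - α * δ := by ring
  have hr₃ : -δ ^ 2 - α * δ - (β ^ 2 - γ ^ 2) / 2 - (-α ^ 2 - δ ^ 2 + (β - γ) ^ 2 / 2) =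
      α ^ 2 - β ^ 2 + β * γ - α * δ := by ring
  rw [hD]
  constructor
  · rintro ⟨h, rfl⟩
    obtain ⟨ha, h⟩ := (g6IsDeriv_diagonal_iff α β γ δ h1 _ _ _).mp h
    obtain rfl := sub_eq_zero.mp ha
    exact ⟨h.imp_right fun h => by linarith, rfl, by rw [sub_self, hr₂, hr₃]⟩
  · rintro ⟨h, rfl, rfl⟩
    exact ⟨(g6IsDeriv_diagonal_iff α β γ δ h1 _ _ _).mpr
      ⟨rfl, h.imp_right fun h => by linarith⟩, by rw [sub_self, hr₂, hr₃]⟩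

theorem stmt16 (α β γ δ : ℝ) (h1 : α + δ ≠ 0) (h2 : α * γ - β * δ = 0) :
    ((∃ (c : ℝ) (D : (Fin 3 → ℝ) →ₗ[ℝ] (Fin 3 → ℝ)), g6IsDeriv α β γ δ D ∧
        g6Ric α β γ δ = c • (LinearMap.id : (Fin 3 → ℝ) →ₗ[ℝ] (Fin 3 → ℝ)) + D) ↔
      ((¬(β = 0 ∧ γ = 0) ∧ α ^ 2 - β ^ 2 = δ ^ 2 - γ ^ 2) ∨ (β = 0 ∧ γ = 0))) ∧
    (¬(β = 0 ∧ γ = 0) → α ^ 2 - β ^ 2 = δ ^ 2 - γ ^ 2 →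
      ∀ (c : ℝ) (D : (Fin 3 → ℝ) →ₗ[ℝ] (Fin 3 → ℝ)),
        (g6IsDeriv α β γ δ D ∧
          g6Ric α β γ δ = c • (LinearMap.id : (Fin 3 → ℝ) →ₗ[ℝ] (Fin 3 → ℝ)) + D) ↔
        (c = -α ^ 2 - δ ^ 2 + (β - γ) ^ 2 / 2 ∧
          D ![1, 0, 0] = 0 ∧
          D ![0, 1, 0] = (α ^ 2 - β ^ 2 + β * γ - α * δ) • (![0, 1, 0] : Fin 3 → ℝ) ∧
          D ![0, 0, 1] = (α ^ 2 - β ^ 2 + β * γ - α * δ) • (![0, 0, 1] : Fin 3 → ℝ))) ∧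
    (β = 0 → γ = 0 →
      ∀ (c : ℝ) (D : (Fin 3 → ℝ) →ₗ[ℝ] (Fin 3 → ℝ)),
        (g6IsDeriv α β γ δ D ∧
          g6Ric α β γ δ = c • (LinearMap.id : (Fin 3 → ℝ) →ₗ[ℝ] (Fin 3 → ℝ)) + D) ↔
        (c = -(α ^ 2 + δ ^ 2) ∧
          D ![1, 0, 0] = 0 ∧
          D ![0, 1, 0] = (δ * (δ - α)) • (![0, 1, 0] : Fin 3 → ℝ) ∧
          D ![0, 0, 1] = (α * (α - δ)) • (![0, 0, 1] : Fin 3 → ℝ))) := by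
  simp only [g6_soliton_iff α β γ δ h1, eq_diagonal_iff, zero_smul]
  refine ⟨⟨?_, fun h => ?_⟩, fun _ h c D => ?_, ?_⟩
  · rintro ⟨c, D, h, -⟩
    tauto
  · exact ⟨_, _, by tauto, rfl, by simpa only [zero_smul] using (eq_diagonal_iff _ 0 _ _).mp rfl⟩
  · simp [h]
  · rintro rfl rfl c D
    rw [show δ ^ 2 - 0 ^ 2 + 0 * 0 - α * δ = δ * (δ - α) by ring,
      show α ^ 2 - 0 ^ 2 + 0 * 0 - α * δ = α * (α - δ) by ring,
      show -α ^ 2 - δ ^ 2 + (0 - 0) ^ 2 / 2 = -(α ^ 2 + δ ^ 2) by ring]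
    simp
end

section
/- There exist a real number c and a derivation D of 𝔤₇ such that Ric = c·Id + D if and only if γ = 0. Moreover, when γ = 0 the unique such pair is c = 0 and D given by D e₁ = 0, D e₂ = α(δ − α)(e₂ + e₃), D e₃ = −α(δ − α)(e₂ + e₃). -/
/-- Bracket of the Lie algebra 𝔤₇ in coordinates w.r.t. the basis {e₁,e₂,e₃}:
[e₁,e₂] = −α e₁ − β e₂ − β e₃, [e₁,e₃] = α e₁ + β e₂ + β e₃, [e₂,e₃] = γ e₁ + δ e₂ + δ e₃. -/
noncomputable def g7bra (α β γ δ : ℝ) (X Y : Fin 3 → ℝ) : Fin 3 → ℝ :=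
  ![-(X 0 * Y 1 - X 1 * Y 0) * α + (X 0 * Y 2 - X 2 * Y 0) * α + (X 1 * Y 2 - X 2 * Y 1) * γ,
    -(X 0 * Y 1 - X 1 * Y 0) * β + (X 0 * Y 2 - X 2 * Y 0) * β + (X 1 * Y 2 - X 2 * Y 1) * δ,
    -(X 0 * Y 1 - X 1 * Y 0) * β + (X 0 * Y 2 - X 2 * Y 0) * β + (X 1 * Y 2 - X 2 * Y 1) * δ]

/-- `D` is a derivation of 𝔤₇. -/
def g7IsDeriv (α β γ δ : ℝ) (D : (Fin 3 → ℝ) →ₗ[ℝ] (Fin 3 → ℝ)) : Prop :=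
  ∀ X Y, D (g7bra α β γ δ X Y) = g7bra α β γ δ (D X) Y + g7bra α β γ δ X (D Y)

/-- The Ricci operator of (G₇, g). -/
noncomputable def g7Ric (α β γ δ : ℝ) : (Fin 3 → ℝ) →ₗ[ℝ] (Fin 3 → ℝ) :=
  Matrix.toLin' !![-γ ^ 2 / 2, 0, 0;
                   0, α * δ - α ^ 2 - β * γ + γ ^ 2 / 2, α ^ 2 - α * δ + β * γ;
                   0, -α ^ 2 + α * δ - β * γ, -α * δ + α ^ 2 + β * γ + γ ^ 2 / 2]

theorem g7Ric_apply (α β γ δ : ℝ) (v : Fin 3 → ℝ) :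
    g7Ric α β γ δ v =
      ![-γ ^ 2 / 2 * v 0,
        (α * δ - α ^ 2 - β * γ + γ ^ 2 / 2) * v 1 + (α ^ 2 - α * δ + β * γ) * v 2,
        (-α ^ 2 + α * δ - β * γ) * v 1 + (-α * δ + α ^ 2 + β * γ + γ ^ 2 / 2) * v 2] := by
  ext i
  fin_cases i <;> simp [g7Ric, Matrix.mulVec, dotProduct, Fin.sum_univ_three]

/-- The Ricci operator of 𝔤₇ differs from a derivation by a multiple `c` of the identity only when
`γ = 0` and `c = 0`. -/
theorem g7IsDeriv_g7Ric_sub_smul_id_iff {α β γ δ : ℝ} (h1 : α + δ ≠ 0) (h2 : α * γ = 0) (c : ℝ) :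
    g7IsDeriv α β γ δ (g7Ric α β γ δ - c • LinearMap.id) ↔ γ = 0 ∧ c = 0 := by
  constructor
  · intro h
    have h12 := h ![1, 0, 0] ![0, 1, 0]
    have h23 := h ![0, 1, 0] ![0, 0, 1]
    have e12 := congrFun h12 0
    have e23 := congrFun h23 0
    have e23' := congrFun h23 1
    simp [g7bra, g7Ric_apply] at e12 e23 e23'
    have hγ : γ = 0 := by
      by_contra hγ
      have hα : α = 0 := (mul_eq_zero.mp h2).resolve_right hγ
      subst hα
      have hδ : δ ≠ 0 := by simpa using h1
      have hc : c = γ ^ 2 / 2 := mul_left_cancel₀ hδ (by linarith)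
      subst hc
      have : γ ^ 3 = 0 := by linarith
      exact hγ (pow_eq_zero_iff (by norm_num) |>.mp this)
    subst hγ
    refine ⟨rfl, (mul_eq_zero.mp (?_ : (α + δ) * c = 0)).resolve_left h1⟩
    linarith
  · rintro ⟨rfl, rfl⟩ X Y
    ext i
    fin_cases i <;> simp [g7bra, g7Ric_apply] <;> ring

theorem stmt18 (α β γ δ : ℝ) (h1 : α + δ ≠ 0) (h2 : α * γ = 0) :
    ((∃ (c : ℝ) (D : (Fin 3 → ℝ) →ₗ[ℝ] (Fin 3 → ℝ)), g7IsDeriv α β γ δ D ∧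
        g7Ric α β γ δ = c • (LinearMap.id : (Fin 3 → ℝ) →ₗ[ℝ] (Fin 3 → ℝ)) + D) ↔
      γ = 0) ∧
    (γ = 0 → ∀ (c : ℝ) (D : (Fin 3 → ℝ) →ₗ[ℝ] (Fin 3 → ℝ)),
      (g7IsDeriv α β γ δ D ∧
        g7Ric α β γ δ = c • (LinearMap.id : (Fin 3 → ℝ) →ₗ[ℝ] (Fin 3 → ℝ)) + D) ↔
      (c = 0 ∧ D ![1, 0, 0] = 0 ∧
        D ![0, 1, 0] = (α * (δ - α)) • (![0, 1, 0] + ![0, 0, 1] : Fin 3 → ℝ) ∧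
        D ![0, 0, 1] = (-(α * (δ - α))) • (![0, 1, 0] + ![0, 0, 1] : Fin 3 → ℝ))) := by
  have key (c : ℝ) (D : (Fin 3 → ℝ) →ₗ[ℝ] (Fin 3 → ℝ)) :
      (g7IsDeriv α β γ δ D ∧ g7Ric α β γ δ = c • LinearMap.id + D) ↔
        (γ = 0 ∧ c = 0) ∧ D = g7Ric α β γ δ := by
    constructor
    · rintro ⟨hD, h⟩
      have hD' : D = g7Ric α β γ δ - c • LinearMap.id := eq_sub_of_add_eq' h.symm
      have hc := (g7IsDeriv_g7Ric_sub_smul_id_iff h1 h2 c).mp (hD' ▸ hD)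
      exact ⟨hc, by rw [hD', hc.2]; simp⟩
    · rintro ⟨hc, rfl⟩
      have hD := (g7IsDeriv_g7Ric_sub_smul_id_iff (β := β) h1 h2 c).mpr hc
      rw [hc.2] at hD ⊢
      simpa using hD
  refine ⟨⟨fun ⟨c, D, h⟩ => ((key c D).mp h).1.1, fun hγ => ⟨0, _, (key 0 _).mpr ⟨⟨hγ, rfl⟩, rfl⟩⟩⟩,
    fun hγ c D => (key c D).trans ?_⟩
  subst hγ
  constructor
  · rintro ⟨⟨-, hc⟩, rfl⟩
    refine ⟨hc, ?_, ?_, ?_⟩ <;> ext i <;> fin_cases i <;> simp [g7Ric_apply] <;> ring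
  · rintro ⟨hc, d1, d2, d3⟩
    refine ⟨⟨rfl, hc⟩, LinearMap.ext fun v => ?_⟩
    have hv : v = v 0 • ![1, 0, 0] + v 1 • ![0, 1, 0] + v 2 • ![0, 0, 1] := by
      ext i
      fin_cases i <;> simp
    rw [hv, map_add, map_add, map_smul, map_smul, map_smul, d1, d2, d3]
    ext i
    fin_cases i <;> simp [g7Ric_apply] <;> ring
end

section
/- Suppose γ = 0 and δ ≠ 0. Then the derivation D of 𝔤₇ defined by D e₁ = 0, D e₂ = α(δ − α)(e₂ + e₃), D e₃ = −α(δ − α)(e₂ + e₃) is inner: D = (α(α − δ)/δ)(ad e₂ + ad e₃), where ad X denotes the linear map Y ↦ [X, Y]. -/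
/-- A linear map killing `e₁` and sending `e₂`, `e₃` to `k (e₂ + e₃)`, `-k (e₂ + e₃)`,
in coordinates. -/
theorem apply_eq_of_basis_values (k : ℝ) (D : (Fin 3 → ℝ) →ₗ[ℝ] (Fin 3 → ℝ))
    (hD1 : D ![1, 0, 0] = 0)
    (hD2 : D ![0, 1, 0] = k • (![0, 1, 0] + ![0, 0, 1] : Fin 3 → ℝ))
    (hD3 : D ![0, 0, 1] = (-k) • (![0, 1, 0] + ![0, 0, 1] : Fin 3 → ℝ))
    (Y : Fin 3 → ℝ) :
    D Y = ![0, k * (Y 1 - Y 2), k * (Y 1 - Y 2)] := by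
  have hY : Y = Y 0 • ![1, 0, 0] + Y 1 • ![0, 1, 0] + Y 2 • ![0, 0, 1] := by
    ext i
    fin_cases i <;> simp
  conv_lhs => rw [hY]
  rw [map_add, map_add, map_smul, map_smul, map_smul, hD1, hD2, hD3]
  ext i
  fin_cases i <;> simp <;> ring

/-- For γ = 0 and δ ≠ 0, the derivation D with D e₁ = 0, D e₂ = α(δ−α)(e₂+e₃),
D e₃ = −α(δ−α)(e₂+e₃) is inner: D = (α(α−δ)/δ)(ad e₂ + ad e₃). -/
theorem stmt19 (α β γ δ : ℝ) (h1 : α + δ ≠ 0) (h2 : α * γ = 0)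
    (hγ : γ = 0) (hδ : δ ≠ 0)
    (D : (Fin 3 → ℝ) →ₗ[ℝ] (Fin 3 → ℝ))
    (hD1 : D ![1, 0, 0] = 0)
    (hD2 : D ![0, 1, 0] = (α * (δ - α)) • (![0, 1, 0] + ![0, 0, 1] : Fin 3 → ℝ))
    (hD3 : D ![0, 0, 1] = (-(α * (δ - α))) • (![0, 1, 0] + ![0, 0, 1] : Fin 3 → ℝ)) :
    g7IsDeriv α β γ δ D ∧
      ∀ Y : Fin 3 → ℝ, D Y = (α * (α - δ) / δ) •
        (g7bra α β γ δ ![0, 1, 0] Y + g7bra α β γ δ ![0, 0, 1] Y) := by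
  have hD := apply_eq_of_basis_values _ D hD1 hD2 hD3
  subst hγ
  constructor
  · intro X Y
    rw [hD, hD X, hD Y]
    ext i
    fin_cases i <;> simp [g7bra] <;> ring
  · intro Y
    rw [hD]
    ext i
    fin_cases i <;> simp [g7bra] <;> field_simp <;> ring
end
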